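/- arXiv:2208.14550 — 6 statements merged into one kernel-verified Lean document; each statement's English description precedes it below -/
import Mathlib

section
/- Let n ≥ 2, r > 0, let g be a C¹ Riemannian metric on an open neighborhood of the closed annulus A(0,.9r,1.1r) ⊂ ℝ^n, and let φ: ℝ → ℝ be smooth with ∫_{.9}^{1.1} φ(ℓ) dℓ ≠ 0. Then the C⁰ local mass equals the weighted average of the classical ADM mass integrand: M_{C⁰}(g, φ, r) = (r ∫_{.9}^{1.1} φ(ℓ) dℓ)^{-1} ∫_{.9r}^{1.1r} φ(u/r) ( ∫_{S(u)} Σ_{i,j=1}^n (∂_j g_{ij}(x) − ∂_i g_{jj}(x)) ν^i(x) dS(x) ) du, where S(u) is the sphere of radius u centered at 0, ν(x) = x/|x|, and dS is the (n−1)-dimensional Euclidean surface measure. -/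
open MeasureTheory Metric

/-- The closed Euclidean annulus `Ā(0,s,t) = {x : s ≤ |x| ≤ t}` in `ℝⁿ`. -/
def closedAnnulus (n : ℕ) (s t : ℝ) : Set (EuclideanSpace ℝ (Fin n)) :=
  {x | s ≤ ‖x‖ ∧ ‖x‖ ≤ t}

/-- The surface integral `∫_{S(u)} f dS` over the sphere of radius `u`
centered at `0` in `ℝⁿ`, expressed via the surface measure `volume.toSphere`
on the unit sphere and the scaling `y ↦ u • y` with Jacobian `u^(n-1)`. -/
noncomputable def sphereIntegral (n : ℕ) (u : ℝ)
    (f : EuclideanSpace ℝ (Fin n) → ℝ) : ℝ :=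
  ∫ y : Metric.sphere (0 : EuclideanSpace ℝ (Fin n)) 1,
    f (u • (y : EuclideanSpace ℝ (Fin n))) * u ^ (n - 1)
    ∂((volume : Measure (EuclideanSpace ℝ (Fin n))).toSphere)

/-- The `C⁰` local mass `M_{C⁰}(g,φ,r)` of a continuous metric `g` on the
annulus `Ā(0,.9r,1.1r)`, with test function `φ` (normalization constant
`(4π(n-1)ω_{n-1})⁻¹` suppressed).  The boundary integral over
`∂Ā(0,.9r,1.1r)` is the sum of the surface integrals over the spheres of
radii `1.1r` (outward normal `ν = x/|x|`) and `.9r` (outward normal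
`ν = -x/|x|`). -/
noncomputable def massC0 (n : ℕ)
    (g : EuclideanSpace ℝ (Fin n) → Matrix (Fin n) (Fin n) ℝ)
    (φ : ℝ → ℝ) (r : ℝ) : ℝ :=
  (r * ∫ ℓ in (0.9 : ℝ)..1.1, φ ℓ)⁻¹ *
    ∑ i : Fin n, ∑ j : Fin n,
      ((∫ x in closedAnnulus n (0.9 * r) (1.1 * r),
          ((((n : ℝ) - 2) / ‖x‖) * φ (‖x‖ / r) + (1 / r) * deriv φ (‖x‖ / r)) *
              ((if i = j then (1 : ℝ) else 0) *
                (g x i j - if i = j then 1 else 0)) +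
            ((1 / ‖x‖) * φ (‖x‖ / r) - (1 / r) * deriv φ (‖x‖ / r)) *
              ((g x i j - if i = j then 1 else 0) * (x i * x j / ‖x‖ ^ 2))) +
        sphereIntegral n (1.1 * r) (fun x =>
          (g x i j - if i = j then 1 else 0) * (x i / ‖x‖) * φ (‖x‖ / r) *
              (x j / ‖x‖) -
            (g x j j - 1) * (x i / ‖x‖) * φ (‖x‖ / r) * (x i / ‖x‖)) +
        sphereIntegral n (0.9 * r) (fun x =>
          (g x i j - if i = j then 1 else 0) * (x i / ‖x‖) * φ (‖x‖ / r) *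
              (-(x j) / ‖x‖) -
            (g x j j - 1) * (x i / ‖x‖) * φ (‖x‖ / r) * (-(x i) / ‖x‖)))

theorem integral_eq_integral_sphereIntegral {n : ℕ} (hn : 2 ≤ n)
    {F : EuclideanSpace ℝ (Fin n) → ℝ} (hF : Integrable F) :
    ∫ x, F x = ∫ u in Set.Ioi (0 : ℝ), sphereIntegral n u F := by
  have : Nontrivial (Fin n) := Fin.nontrivial_iff_two_le.mpr hn
  have hmp := (volume : Measure (EuclideanSpace ℝ (Fin n))).measurePreserving_homeomorphUnitSphereProd
  have hemb := Homeomorph.measurableEmbedding (homeomorphUnitSphereProd (EuclideanSpace ℝ (Fin n)))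
  rw [finrank_euclideanSpace_fin] at hmp
  set Φ : Metric.sphere (0 : EuclideanSpace ℝ (Fin n)) 1 × Set.Ioi (0 : ℝ) → ℝ :=
    fun p => F ((p.2 : ℝ) • (p.1 : EuclideanSpace ℝ (Fin n))) with hΦ
  have hcomp : ∀ x : ({0}ᶜ : Set (EuclideanSpace ℝ (Fin n))),
      Φ (homeomorphUnitSphereProd _ x) = F x := by
    intro x
    have hx : ‖(x : EuclideanSpace ℝ (Fin n))‖ ≠ 0 := norm_ne_zero_iff.mpr x.2
    simp [hΦ, smul_smul, hx]
  have hint : Integrable Φ ((volume : Measure (EuclideanSpace ℝ (Fin n))).toSphere.prod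
      (Measure.volumeIoiPow (n - 1))) := by
    rw [← hmp.integrable_comp_emb hemb]
    have : Φ ∘ (homeomorphUnitSphereProd (EuclideanSpace ℝ (Fin n))) = F ∘ Subtype.val :=
      funext hcomp
    rw [this, ← integrableOn_iff_comap_subtypeVal (measurableSet_singleton _).compl]
    exact hF.integrableOn
  calc ∫ x, F x = ∫ x : ({0}ᶜ : Set (EuclideanSpace ℝ (Fin n))), F x
          ∂(volume.comap Subtype.val) := by
        rw [integral_subtype_comap (measurableSet_singleton _).compl F,
          restrict_compl_singleton]
    _ = ∫ p, Φ p ∂((volume : Measure (EuclideanSpace ℝ (Fin n))).toSphere.prod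
          (Measure.volumeIoiPow (n - 1))) := by
        rw [← hmp.integral_comp hemb]
        exact integral_congr_ae (.of_forall fun x => (hcomp x).symm)
    _ = ∫ u : Set.Ioi (0 : ℝ), (∫ y, Φ (y, u)
          ∂(volume : Measure (EuclideanSpace ℝ (Fin n))).toSphere)
          ∂(Measure.volumeIoiPow (n - 1)) := integral_prod_symm _ hint
    _ = ∫ u in Set.Ioi (0 : ℝ), sphereIntegral n u F := by
        simp only [Measure.volumeIoiPow, ENNReal.ofReal]
        rw [integral_withDensity_eq_integral_smul
            (measurable_subtype_coe.pow_const _).real_toNNReal,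
          ← integral_subtype_comap measurableSet_Ioi fun u => sphereIntegral n u F]
        refine integral_congr_ae (.of_forall fun u => ?_)
        have hu : (0 : ℝ) < u := u.2
        simp only [sphereIntegral, hΦ, integral_mul_const, NNReal.smul_def, smul_eq_mul,
          Real.coe_toNNReal _ (pow_nonneg hu.le _)]
        ring

theorem sphereIntegral_congr {n : ℕ} {u : ℝ} (hu : 0 ≤ u)
    {f g : EuclideanSpace ℝ (Fin n) → ℝ} (h : ∀ x, ‖x‖ = u → f x = g x) :
    sphereIntegral n u f = sphereIntegral n u g := by
  refine integral_congr_ae (.of_forall fun y => ?_)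
  have hy : ‖u • (y : EuclideanSpace ℝ (Fin n))‖ = u := by
    simp [norm_smul, abs_of_nonneg hu]
  simp only [h _ hy]

theorem continuous_sphereIntegral {n : ℕ} {f : EuclideanSpace ℝ (Fin n) → ℝ}
    (hf : Continuous f) : Continuous fun u => sphereIntegral n u f := by
  have := continuous_parametric_integral_of_continuous
    (μ := (volume : Measure (EuclideanSpace ℝ (Fin n))).toSphere)
    (f := fun (u : ℝ) (y : Metric.sphere (0 : EuclideanSpace ℝ (Fin n)) 1) =>
      f (u • (y : EuclideanSpace ℝ (Fin n))) * u ^ (n - 1)) (by fun_prop) isCompact_univ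
  simpa [sphereIntegral] using this

/-- Fundamental theorem of calculus for a weak derivative. -/
theorem sub_eq_integral_of_weak_deriv {a b : ℝ} {G D : ℝ → ℝ} (hG : Continuous G)
    (hD : Continuous D)
    (h : ∀ ψ : ℝ → ℝ, ContDiff ℝ 1 ψ → (∀ u, u ∉ Set.Ioo a b → ψ u = 0) →
      ∫ u in a..b, (ψ u * D u + deriv ψ u * G u) = 0)
    {s t : ℝ} (hs : s ∈ Set.Ioo a b) (ht : t ∈ Set.Ioo a b) :
    G t - G s = ∫ u in s..t, D u := by
  have hab : a < b := hs.1.trans hs.2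
  set H : ℝ → ℝ := fun u => G u - ∫ v in a..u, D v with hH
  have hKd : ∀ u, HasDerivAt (fun u => ∫ v in a..u, D v) (D u) u := fun u =>
    intervalIntegral.integral_hasDerivAt_right (hD.intervalIntegrable _ _)
      (hD.stronglyMeasurableAtFilter _ _) hD.continuousAt
  have hK : Continuous (fun u => ∫ v in a..u, D v) :=
    continuous_iff_continuousAt.mpr fun u => (hKd u).continuousAt
  have hHc : Continuous H := hG.sub hK
  set w : ℝ → ℝ := fun u => max 0 ((u - a) * (b - u)) with hw
  have hwc : Continuous w := by fun_prop
  have hw0 : ∀ u, 0 ≤ w u := fun u => le_max_left _ _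
  have hwpos : ∀ u ∈ Set.Ioo a b, 0 < w u := fun u hu =>
    lt_max_of_lt_right (mul_pos (sub_pos.mpr hu.1) (sub_pos.mpr hu.2))
  have hwout : ∀ u, u ∉ Set.Ioo a b → w u = 0 := by
    intro u hu
    refine max_eq_left ?_
    by_cases hua : a < u
    · exact mul_nonpos_of_nonneg_of_nonpos (by linarith)
        (by have := not_and.mp hu hua; linarith)
    · exact mul_nonpos_of_nonpos_of_nonneg (by linarith) (by linarith)
  have hW : 0 < ∫ u in a..b, w u :=
    intervalIntegral.intervalIntegral_pos_of_pos_on (hwc.intervalIntegrable _ _) hwpos hab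
  set c : ℝ := (∫ u in a..b, w u * H u) / ∫ u in a..b, w u with hc
  set q : ℝ → ℝ := fun u => w u * (H u - c) with hq
  have hqc : Continuous q := by fun_prop
  set ψ : ℝ → ℝ := fun u => ∫ v in a..u, q v with hψ
  have hψd : ∀ u, HasDerivAt ψ (q u) u := fun u =>
    intervalIntegral.integral_hasDerivAt_right (hqc.intervalIntegrable _ _)
      (hqc.stronglyMeasurableAtFilter _ _) hqc.continuousAt
  have hψ' : deriv ψ = q := funext fun u => (hψd u).deriv
  have hqout : ∀ u, u ∉ Set.Ioo a b → q u = 0 := fun u hu => by simp [hq, hwout u hu]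
  have hψb : ψ b = 0 := by
    have : ∀ u, q u = w u * H u - w u * c := fun u => by simp only [hq]; ring
    simp only [hψ, this]
    rw [intervalIntegral.integral_sub
      (Continuous.intervalIntegrable (by fun_prop) _ _)
      (Continuous.intervalIntegrable (by fun_prop) _ _),
      intervalIntegral.integral_mul_const, hc]
    field_simp
    ring
  have hψc1 : ContDiff ℝ 1 ψ := by
    rw [contDiff_one_iff_deriv]
    exact ⟨fun u => (hψd u).differentiableAt, hψ' ▸ hqc⟩
  have hψout : ∀ u, u ∉ Set.Ioo a b → ψ u = 0 := by
    intro u hu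
    by_cases hua : a < u
    · have hub : b ≤ u := not_lt.mp (not_and.mp hu hua)
      have h1 : ψ u = ψ b + ∫ v in b..u, q v :=
        (intervalIntegral.integral_add_adjacent_intervals (hqc.intervalIntegrable _ _)
          (hqc.intervalIntegrable _ _)).symm
      rw [h1, hψb, zero_add]
      refine intervalIntegral.integral_zero_ae (.of_forall fun v hv => hqout v fun hv' => ?_)
      rw [Set.uIoc_of_le hub] at hv
      exact absurd hv.1 (not_lt.mpr hv'.2.le)
    · refine intervalIntegral.integral_zero_ae (.of_forall fun v hv => hqout v fun hv' => ?_)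
      rw [Set.uIoc_of_ge (not_lt.mp hua)] at hv
      exact absurd hv.2 (not_le.mpr hv'.1)
  have hψa : ψ a = 0 := hψout a (by simp)
  have h1 := h ψ hψc1 hψout
  have h2 : ∫ u in a..b, (q u * (∫ v in a..u, D v) + ψ u * D u) = 0 := by
    rw [intervalIntegral.integral_deriv_mul_eq_sub (fun u _ => hψd u) (fun u _ => hKd u)
      (hqc.intervalIntegrable _ _) (hD.intervalIntegrable _ _), hψb, hψa]
    simp
  have hψcont : Continuous ψ := hψc1.continuous
  have h3 : ∫ u in a..b, w u * (H u - c) ^ 2 = 0 := by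
    have e : ∀ u, w u * (H u - c) ^ 2 = (ψ u * D u + deriv ψ u * G u)
        - (q u * (∫ v in a..u, D v) + ψ u * D u) - c * q u := fun u => by
      rw [hψ']; simp only [hq, hH]; ring
    simp only [e]
    rw [hψ'] at *
    rw [intervalIntegral.integral_sub (Continuous.intervalIntegrable (by fun_prop) _ _)
      (Continuous.intervalIntegrable (by fun_prop) _ _),
      intervalIntegral.integral_sub (Continuous.intervalIntegrable (by fun_prop) _ _)
      (Continuous.intervalIntegrable (by fun_prop) _ _), h1, h2,
      intervalIntegral.integral_const_mul]
    have : ∫ v in a..b, q v = 0 := hψb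
    rw [this]; simp
  have h4 : ∀ u ∈ Set.Ioo a b, H u = c := by
    intro u hu
    by_contra hne
    have : 0 < ∫ u in a..b, w u * (H u - c) ^ 2 := by
      refine intervalIntegral.integral_pos hab (Continuous.continuousOn (by fun_prop))
        (fun v _ => mul_nonneg (hw0 v) (sq_nonneg _)) ⟨u, ⟨hu.1.le, hu.2.le⟩, ?_⟩
      exact mul_pos (hwpos u hu) (sq_pos_of_ne_zero (sub_ne_zero.mpr hne))
    exact this.ne' h3
  have h5 := (h4 t ht).trans (h4 s hs).symm
  simp only [hH] at h5
  rw [← intervalIntegral.integral_interval_sub_left (hD.intervalIntegrable a t)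
    (hD.intervalIntegrable a s)]
  linarith

theorem hasFDerivAt_norm_of_ne_zero {E : Type*} [NormedAddCommGroup E] [InnerProductSpace ℝ E]
    {x : E} (hx : x ≠ 0) : HasFDerivAt (fun y : E => ‖y‖) (‖x‖⁻¹ • innerSL ℝ x) x := by
  have h := (hasStrictFDerivAt_norm_sq x).hasFDerivAt.sqrt
    (pow_ne_zero 2 (norm_ne_zero_iff.mpr hx))
  simp only [Real.sqrt_sq (norm_nonneg _)] at h
  refine h.congr_fderiv ?_
  ext v
  have := norm_ne_zero_iff.mpr hx
  simp
  field_simp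

theorem contDiff_comp_norm_of_eq_zero {E : Type*} [NormedAddCommGroup E] [InnerProductSpace ℝ E]
    {ψ : ℝ → ℝ} (hψ : ContDiff ℝ 1 ψ) {a : ℝ} (ha : 0 < a) (h0 : ∀ u ≤ a, ψ u = 0) :
    ContDiff ℝ 1 fun x : E => ψ ‖x‖ := by
  rw [contDiff_iff_contDiffAt]
  intro x
  by_cases hx : x = 0
  · have : (fun x : E => ψ ‖x‖) =ᶠ[nhds x] fun _ => 0 := by
      filter_upwards [ball_mem_nhds x ha] with y hy
      rw [hx, mem_ball_zero_iff] at hy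
      exact h0 _ hy.le
    exact contDiffAt_const.congr_of_eventuallyEq this
  · exact hψ.contDiffAt.comp x (contDiffAt_norm ℝ hx)

theorem fderiv_comp_norm_single {n : ℕ} {ψ : ℝ → ℝ} {x : EuclideanSpace ℝ (Fin n)}
    (hψ : DifferentiableAt ℝ ψ ‖x‖) (hx : x ≠ 0) (j : Fin n) :
    fderiv ℝ (fun y => ψ ‖y‖) x (EuclideanSpace.single j 1) = deriv ψ ‖x‖ * (x j / ‖x‖) := by
  have := hψ.hasDerivAt.comp_hasFDerivAt x (hasFDerivAt_norm_of_ne_zero hx)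
  rw [show (fun y : EuclideanSpace ℝ (Fin n) => ψ ‖y‖) = ψ ∘ fun y => ‖y‖ from rfl, this.fderiv]
  simp only [smul_apply, innerSL_apply_apply, EuclideanSpace.inner_single_right, smul_eq_mul, one_mul]
  simp [div_eq_inv_mul]

theorem integrable_sphereIntegrand {n : ℕ} {u : ℝ} (hu : 0 ≤ u)
    {f : EuclideanSpace ℝ (Fin n) → ℝ} (hf : ContinuousOn f {x | ‖x‖ = u}) :
    Integrable (fun y : Metric.sphere (0 : EuclideanSpace ℝ (Fin n)) 1 =>
      f (u • (y : EuclideanSpace ℝ (Fin n))) * u ^ (n - 1))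
      (volume : Measure (EuclideanSpace ℝ (Fin n))).toSphere := by
  have hc : Continuous fun y : Metric.sphere (0 : EuclideanSpace ℝ (Fin n)) 1 =>
      f (u • (y : EuclideanSpace ℝ (Fin n))) * u ^ (n - 1) :=
    (hf.comp_continuous (by fun_prop) fun y => by
      simp [norm_smul, abs_of_nonneg hu]).mul continuous_const
  exact hc.integrable_of_hasCompactSupport (HasCompactSupport.of_compactSpace _)

theorem sphereIntegral_add {n : ℕ} {u : ℝ} (hu : 0 ≤ u)
    {f g : EuclideanSpace ℝ (Fin n) → ℝ} (hf : ContinuousOn f {x | ‖x‖ = u})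
    (hg : ContinuousOn g {x | ‖x‖ = u}) :
    sphereIntegral n u (fun x => f x + g x) = sphereIntegral n u f + sphereIntegral n u g := by
  simp only [sphereIntegral, add_mul]
  exact integral_add (integrable_sphereIntegrand hu hf) (integrable_sphereIntegrand hu hg)

theorem sphereIntegral_neg {n : ℕ} {u : ℝ} (f : EuclideanSpace ℝ (Fin n) → ℝ) :
    sphereIntegral n u (fun x => -f x) = -sphereIntegral n u f := by
  simp only [sphereIntegral, neg_mul, integral_neg]

theorem sphereIntegral_sub {n : ℕ} {u : ℝ} (hu : 0 ≤ u)
    {f g : EuclideanSpace ℝ (Fin n) → ℝ} (hf : ContinuousOn f {x | ‖x‖ = u})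
    (hg : ContinuousOn g {x | ‖x‖ = u}) :
    sphereIntegral n u (fun x => f x - g x) = sphereIntegral n u f - sphereIntegral n u g := by
  simp only [sphereIntegral, sub_mul]
  exact integral_sub (integrable_sphereIntegrand hu hf) (integrable_sphereIntegrand hu hg)

theorem sphereIntegral_mul_radial {n : ℕ} {u : ℝ} (hu : 0 ≤ u) (η : ℝ → ℝ)
    (f : EuclideanSpace ℝ (Fin n) → ℝ) :
    sphereIntegral n u (fun x => η ‖x‖ * f x) = η u * sphereIntegral n u f := by
  rw [sphereIntegral_congr hu (g := fun x => η u * f x) fun x hx => by rw [hx]]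
  simp only [sphereIntegral, mul_assoc, integral_const_mul]

theorem measurableSet_closedAnnulus (n : ℕ) (s t : ℝ) : MeasurableSet (closedAnnulus n s t) :=
  (measurableSet_le measurable_const measurable_norm).inter
    (measurableSet_le measurable_norm measurable_const)

theorem isClosed_closedAnnulus (n : ℕ) (s t : ℝ) : IsClosed (closedAnnulus n s t) :=
  (isClosed_le continuous_const continuous_norm).inter
    (isClosed_le continuous_norm continuous_const)

theorem isCompact_closedAnnulus (n : ℕ) (s t : ℝ) : IsCompact (closedAnnulus n s t) :=
  (isCompact_closedBall (0 : EuclideanSpace ℝ (Fin n)) t).of_isClosed_subset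
    (isClosed_closedAnnulus n s t) fun _ hx => mem_closedBall_zero_iff.mpr hx.2

theorem setIntegral_closedAnnulus {n : ℕ} (hn : 2 ≤ n) {s t : ℝ} (hs : 0 < s) (hst : s ≤ t)
    {F : EuclideanSpace ℝ (Fin n) → ℝ} (hF : IntegrableOn F (closedAnnulus n s t)) :
    ∫ x in closedAnnulus n s t, F x = ∫ u in s..t, sphereIntegral n u F := by
  have hind : (closedAnnulus n s t).indicator F =
      fun x => (Set.Icc s t).indicator 1 ‖x‖ * F x := by
    ext x
    by_cases hx : x ∈ closedAnnulus n s t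
    · rw [Set.indicator_of_mem hx, Set.indicator_of_mem (show ‖x‖ ∈ Set.Icc s t from hx)]
      simp
    · rw [Set.indicator_of_notMem hx, Set.indicator_of_notMem (show ‖x‖ ∉ Set.Icc s t from hx)]
      simp
  rw [← integral_indicator (measurableSet_closedAnnulus n s t),
    integral_eq_integral_sphereIntegral hn
      ((integrable_indicator_iff (measurableSet_closedAnnulus n s t)).mpr hF), hind,
    setIntegral_congr_fun (g := (Set.Icc s t).indicator fun u => sphereIntegral n u F)
      measurableSet_Ioi, setIntegral_indicator measurableSet_Icc,
    intervalIntegral.integral_of_le hst, ← integral_Icc_eq_integral_Ioc,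
    Set.inter_eq_right.mpr fun u hu => Set.mem_Ioi.mpr (hs.trans_le hu.1)]
  intro u hu
  simp only
  rw [sphereIntegral_mul_radial (le_of_lt hu)]
  by_cases h : u ∈ Set.Icc s t
  · simp [h]
  · simp [h]

/-- The divergence theorem on an annulus, for one coordinate direction and a function that is
`C¹` on the whole space. -/
theorem setIntegral_fderiv_closedAnnulus_of_contDiff {n : ℕ} (hn : 2 ≤ n) {s t : ℝ} (hs : 0 < s)
    (hst : s ≤ t) {f : EuclideanSpace ℝ (Fin n) → ℝ} (hf : ContDiff ℝ 1 f) (j : Fin n) :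
    ∫ x in closedAnnulus n s t, fderiv ℝ f x (EuclideanSpace.single j 1) =
      sphereIntegral n t (fun x => f x * (x j / ‖x‖)) -
        sphereIntegral n s (fun x => f x * (x j / ‖x‖)) := by
  set D : EuclideanSpace ℝ (Fin n) → ℝ := fun x => fderiv ℝ f x (EuclideanSpace.single j 1) with hD
  have hfc : Continuous f := hf.continuous
  have hDc : Continuous D := (hf.continuous_fderiv one_ne_zero).clm_apply continuous_const
  set G : ℝ → ℝ := fun u => ∫ y : Metric.sphere (0 : EuclideanSpace ℝ (Fin n)) 1,
    f (u • (y : EuclideanSpace ℝ (Fin n))) * (y : EuclideanSpace ℝ (Fin n)) j * u ^ (n - 1)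
      ∂(volume : Measure (EuclideanSpace ℝ (Fin n))).toSphere with hG
  have hGc : Continuous G := by
    have := continuous_parametric_integral_of_continuous
      (μ := (volume : Measure (EuclideanSpace ℝ (Fin n))).toSphere)
      (f := fun (u : ℝ) (y : Metric.sphere (0 : EuclideanSpace ℝ (Fin n)) 1) =>
        f (u • (y : EuclideanSpace ℝ (Fin n))) * (y : EuclideanSpace ℝ (Fin n)) j * u ^ (n - 1))
      (by fun_prop) isCompact_univ
    simpa using this
  have hGs : ∀ u, 0 < u → sphereIntegral n u (fun x => f x * (x j / ‖x‖)) = G u := by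
    intro u hu
    refine integral_congr_ae (.of_forall fun y => ?_)
    have hy : ‖u • (y : EuclideanSpace ℝ (Fin n))‖ = u := by
      simp [norm_smul, abs_of_nonneg hu.le]
    simp only [hy, PiLp.smul_apply, smul_eq_mul]
    field_simp
  rw [setIntegral_closedAnnulus hn hs hst
    (hDc.continuousOn.integrableOn_compact (isCompact_closedAnnulus n s t)),
    hGs t (hs.trans_le hst), hGs s hs]
  refine (sub_eq_integral_of_weak_deriv (a := s / 2) (b := t + 1) hGc
    (continuous_sphereIntegral hDc) (fun ψ hψ hψ0 => ?_) ⟨by linarith, by linarith⟩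
    ⟨by linarith, by linarith⟩).symm
  have hlow : ∀ u ≤ s / 2, ψ u = 0 := fun u hu => hψ0 u fun h => absurd h.1 (not_lt.mpr hu)
  have hhigh : ∀ u, t + 1 ≤ u → ψ u = 0 := fun u hu => hψ0 u fun h => absurd h.2 (not_lt.mpr hu)
  have hΨ : ContDiff ℝ 1 fun x : EuclideanSpace ℝ (Fin n) => ψ ‖x‖ :=
    contDiff_comp_norm_of_eq_zero hψ (half_pos hs) hlow
  have hsupp : HasCompactSupport fun x : EuclideanSpace ℝ (Fin n) => ψ ‖x‖ :=
    HasCompactSupport.intro (isCompact_closedBall 0 (t + 1)) fun x hx => by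
      rw [mem_closedBall_zero_iff, not_le] at hx
      exact hhigh _ hx.le
  have hΨd : Continuous fun x : EuclideanSpace ℝ (Fin n) =>
      fderiv ℝ (fun x => ψ ‖x‖) x (EuclideanSpace.single j (1 : ℝ)) :=
    (hΨ.continuous_fderiv one_ne_zero).clm_apply continuous_const
  have hsupp' : HasCompactSupport fun x : EuclideanSpace ℝ (Fin n) =>
      fderiv ℝ (fun x => ψ ‖x‖) x (EuclideanSpace.single j (1 : ℝ)) :=
    hsupp.fderiv_apply ℝ _
  have hi1 : Integrable (fun x : EuclideanSpace ℝ (Fin n) =>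
      fderiv ℝ (fun x => ψ ‖x‖) x (EuclideanSpace.single j (1 : ℝ)) * f x) :=
    (hΨd.mul hfc).integrable_of_hasCompactSupport hsupp'.mul_right
  have hi2 : Integrable (fun x : EuclideanSpace ℝ (Fin n) => ψ ‖x‖ * D x) :=
    (hΨ.continuous.mul hDc).integrable_of_hasCompactSupport hsupp.mul_right
  have hparts := integral_mul_fderiv_eq_neg_fderiv_mul_of_integrable hi1 hi2
    ((hΨ.continuous.mul hfc).integrable_of_hasCompactSupport hsupp.mul_right)
    (fun x _ => (hΨ.differentiable one_ne_zero) x)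
    (fun x _ => (hf.differentiable one_ne_zero) x)
  have hzero : ∫ x, (ψ ‖x‖ * D x +
      fderiv ℝ (fun x => ψ ‖x‖) x (EuclideanSpace.single j (1 : ℝ)) * f x) = 0 := by
    rw [integral_add hi2 hi1, hparts, neg_add_cancel]
  rw [integral_eq_integral_sphereIntegral (F := fun x => ψ ‖x‖ * D x +
      fderiv ℝ (fun x => ψ ‖x‖) x (EuclideanSpace.single j (1 : ℝ)) * f x)
    hn (hi2.add hi1)] at hzero
  have hdout : ∀ u, t + 1 < u → deriv ψ u = 0 := by
    intro u hu
    have : ψ =ᶠ[nhds u] fun _ => 0 := by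
      filter_upwards [Ioi_mem_nhds hu] with v hv using hhigh v (le_of_lt hv)
    rw [this.deriv_eq, deriv_const]
  have hdlow : ∀ u, u < s / 2 → deriv ψ u = 0 := by
    intro u hu
    have : ψ =ᶠ[nhds u] fun _ => 0 := by
      filter_upwards [Iio_mem_nhds hu] with v hv using hlow v (le_of_lt hv)
    rw [this.deriv_eq, deriv_const]
  have hsph : ∀ u ∈ Set.Ioi (0 : ℝ), sphereIntegral n u (fun x => ψ ‖x‖ * D x +
      fderiv ℝ (fun x => ψ ‖x‖) x (EuclideanSpace.single j (1 : ℝ)) * f x) =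
      ψ u * sphereIntegral n u D + deriv ψ u * G u := by
    intro u hu
    have hu' : (0 : ℝ) < u := hu
    have hne : ∀ x : EuclideanSpace ℝ (Fin n), ‖x‖ = u → ‖x‖ ≠ 0 := fun x hx => hx ▸ hu'.ne'
    have hψ'c : Continuous (deriv ψ) := hψ.continuous_deriv le_rfl
    have hψc : Continuous ψ := hψ.continuous
    rw [← hGs u hu', ← sphereIntegral_mul_radial hu'.le, ← sphereIntegral_mul_radial hu'.le,
      ← sphereIntegral_add hu'.le (Continuous.continuousOn (by fun_prop))
        (by fun_prop (disch := simpa using hne))]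
    refine sphereIntegral_congr hu'.le fun x hx => ?_
    rw [fderiv_comp_norm_single ((hψ.differentiable one_ne_zero) _)
      (norm_ne_zero_iff.mp (hne x hx))]
    ring
  rw [setIntegral_congr_fun measurableSet_Ioi hsph] at hzero
  rw [intervalIntegral.integral_of_le (by linarith), ← hzero]
  rw [← integral_Icc_eq_integral_Ioc]
  symm
  refine setIntegral_eq_of_subset_of_forall_sdiff_eq_zero measurableSet_Ioi
    (fun u hu => Set.mem_Ioi.mpr ((half_pos hs).trans_le hu.1)) fun u hu => ?_
  rcases lt_or_ge u (s / 2) with h | h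
  · rw [hlow u h.le, hdlow u h]; simp
  · have h' : t + 1 < u := not_le.mp fun h' => hu.2 ⟨h, h'⟩
    rw [hhigh u h'.le, hdout u h']; simp

/-- A function that is `C¹` near a closed set agrees near it with one that is `C¹` everywhere. -/
theorem exists_contDiff_eventuallyEq_of_contDiffOn {E : Type*} [NormedAddCommGroup E]
    [NormedSpace ℝ E] [FiniteDimensional ℝ E] {A U : Set E} (hA : IsClosed A) (hU : IsOpen U)
    (hAU : A ⊆ U) {f : E → ℝ} (hf : ContDiffOn ℝ 1 f U) :
    ∃ F : E → ℝ, ContDiff ℝ 1 F ∧ ∀ x ∈ A, F =ᶠ[nhds x] f := by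
  obtain ⟨V, hV, hAV, hVU⟩ := normal_exists_closure_subset hA hU hAU
  obtain ⟨χ, h1, h0, -⟩ := exists_contMDiffMap_one_nhds_of_subset_interior (n := 1)
    (modelWithCornersSelf ℝ E) hA (hV.interior_eq.symm ▸ hAV : A ⊆ interior V)
  have hχ : ContDiff ℝ 1 χ := χ.contMDiff.contDiff
  refine ⟨fun x => χ x * f x, contDiff_iff_contDiffAt.mpr fun x => ?_, fun x hx => ?_⟩
  · by_cases hx : x ∈ U
    · exact hχ.contDiffAt.mul (hf.contDiffAt (hU.mem_nhds hx))
    · have : (fun x => χ x * f x) =ᶠ[nhds x] fun _ => 0 := by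
        filter_upwards [isClosed_closure.isOpen_compl.mem_nhds fun h => hx (hVU h)] with y hy
        rw [h0 y fun h => hy (subset_closure h), zero_mul]
      exact contDiffAt_const.congr_of_eventuallyEq this
  · filter_upwards [h1.filter_mono (nhds_le_nhdsSet hx)] with y hy
    rw [hy, one_mul]

/-- The divergence theorem on an annulus, for one coordinate direction. -/
theorem setIntegral_fderiv_closedAnnulus {n : ℕ} (hn : 2 ≤ n) {s t : ℝ} (hs : 0 < s)
    (hst : s ≤ t) {U : Set (EuclideanSpace ℝ (Fin n))} (hU : IsOpen U)
    (hAU : closedAnnulus n s t ⊆ U) {f : EuclideanSpace ℝ (Fin n) → ℝ} (hf : ContDiffOn ℝ 1 f U)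
    (j : Fin n) :
    ∫ x in closedAnnulus n s t, fderiv ℝ f x (EuclideanSpace.single j 1) =
      sphereIntegral n t (fun x => f x * (x j / ‖x‖)) -
        sphereIntegral n s (fun x => f x * (x j / ‖x‖)) := by
  obtain ⟨F, hF, hFf⟩ :=
    exists_contDiff_eventuallyEq_of_contDiffOn (isClosed_closedAnnulus n s t) hU hAU hf
  have h := setIntegral_fderiv_closedAnnulus_of_contDiff hn hs hst hF j
  rw [setIntegral_congr_fun (measurableSet_closedAnnulus n s t) fun x hx => by
      rw [← (hFf x hx).fderiv_eq], h]
  congr 1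
  · exact sphereIntegral_congr (hs.le.trans hst) fun x hx => by
      rw [(hFf x ⟨hx ▸ hst, hx.le⟩).eq_of_nhds]
  · exact sphereIntegral_congr hs.le fun x hx => by
      rw [(hFf x ⟨hx.ge, hx ▸ hst⟩).eq_of_nhds]

theorem fderiv_coord_div_norm {n : ℕ} {x : EuclideanSpace ℝ (Fin n)} (hx : x ≠ 0) (i j : Fin n) :
    DifferentiableAt ℝ (fun y : EuclideanSpace ℝ (Fin n) => y i / ‖y‖) x ∧
    fderiv ℝ (fun y : EuclideanSpace ℝ (Fin n) => y i / ‖y‖) x (EuclideanSpace.single j 1) =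
      (if i = j then 1 else 0) / ‖x‖ - x i * x j / ‖x‖ ^ 3 := by
  have hN : ‖x‖ ≠ 0 := norm_ne_zero_iff.mpr hx
  have h1 : HasFDerivAt (fun y : EuclideanSpace ℝ (Fin n) => y i)
      (EuclideanSpace.proj i : EuclideanSpace ℝ (Fin n) →L[ℝ] ℝ) x :=
    (EuclideanSpace.proj i : EuclideanSpace ℝ (Fin n) →L[ℝ] ℝ).hasFDerivAt
  have h2 := h1.mul ((hasDerivAt_inv hN).comp_hasFDerivAt x (hasFDerivAt_norm_of_ne_zero hx))
  refine ⟨h2.differentiableAt, ?_⟩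
  rw [show (fun y : EuclideanSpace ℝ (Fin n) => y i / ‖y‖) =
    (fun y => y i) * ((fun u : ℝ => u⁻¹) ∘ fun y => ‖y‖) from rfl, h2.fderiv]
  simp [EuclideanSpace.inner_single_right]
  split_ifs <;> field_simp <;> ring

/-- Integration by parts on an annulus against the radial weight `φ(|x|/r) xⁱ/|x|`. -/
theorem setIntegral_radial_mul_fderiv {n : ℕ} (hn : 2 ≤ n) {s t : ℝ} (hs : 0 < s)
    (hst : s ≤ t) {U : Set (EuclideanSpace ℝ (Fin n))} (hU : IsOpen U)
    (hAU : closedAnnulus n s t ⊆ U) {h : EuclideanSpace ℝ (Fin n) → ℝ} (hh : ContDiffOn ℝ 1 h U)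
    {φ : ℝ → ℝ} (hφ : ContDiff ℝ 1 φ) (r : ℝ) (i j : Fin n) :
    ∫ x in closedAnnulus n s t,
        φ (‖x‖ / r) * (fderiv ℝ h x (EuclideanSpace.single j 1) * (x i / ‖x‖)) =
      sphereIntegral n t (fun x => h x * (x i / ‖x‖) * φ (‖x‖ / r) * (x j / ‖x‖)) -
        sphereIntegral n s (fun x => h x * (x i / ‖x‖) * φ (‖x‖ / r) * (x j / ‖x‖)) -
        ∫ x in closedAnnulus n s t, h x * (deriv φ (‖x‖ / r) / r * (x i * x j / ‖x‖ ^ 2) +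
          φ (‖x‖ / r) * ((if i = j then 1 else 0) / ‖x‖ - x i * x j / ‖x‖ ^ 3)) := by
  have hne : ∀ x ∈ closedAnnulus n s t, ‖x‖ ≠ 0 := fun x hx => (hs.trans_le hx.1).ne'
  have hφc : Continuous φ := hφ.continuous
  have hφ'c : Continuous (deriv φ) := hφ.continuous_deriv le_rfl
  have hhc : ContinuousOn h (closedAnnulus n s t) := hh.continuousOn.mono hAU
  have hdc : ContinuousOn (fun x => fderiv ℝ h x (EuclideanSpace.single j (1 : ℝ)))
      (closedAnnulus n s t) :=
    ((hh.continuousOn_fderiv_of_isOpen hU le_rfl).mono hAU).clm_apply continuousOn_const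
  have hK := isCompact_closedAnnulus n s t
  have hU0 : IsOpen (U \ {0}) := hU.sdiff isClosed_singleton
  have hAU0 : closedAnnulus n s t ⊆ U \ {0} := fun x hx =>
    ⟨hAU hx, norm_ne_zero_iff.mp (hne x hx)⟩
  have hf : ContDiffOn ℝ 1 (fun x => h x * (x i / ‖x‖) * φ (‖x‖ / r)) (U \ {0}) := by
    intro x hx
    have hx0 : x ≠ 0 := hx.2
    have hN : ContDiffAt ℝ 1 (fun y : EuclideanSpace ℝ (Fin n) => ‖y‖) x := contDiffAt_norm ℝ hx0
    have hi : ContDiffAt ℝ 1 (fun y : EuclideanSpace ℝ (Fin n) => y i) x :=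
      (EuclideanSpace.proj i : EuclideanSpace ℝ (Fin n) →L[ℝ] ℝ).contDiff.contDiffAt
    exact (((hh.contDiffAt (hU.mem_nhds hx.1)).mul
      (hi.div hN (norm_ne_zero_iff.mpr hx0))).mul
      (hφ.contDiffAt.comp x (hN.div_const r))).contDiffWithinAt
  rw [← setIntegral_fderiv_closedAnnulus hn hs hst hU0 hAU0 hf j, ← integral_sub]
  · refine setIntegral_congr_fun (measurableSet_closedAnnulus n s t) fun x hx => ?_
    have hN := hne x hx
    have hx0 := norm_ne_zero_iff.mp hN
    have hhd : DifferentiableAt ℝ h x :=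
      (hh.contDiffAt (hU.mem_nhds (hAU hx))).differentiableAt one_ne_zero
    obtain ⟨hed, he⟩ := fderiv_coord_div_norm hx0 i j
    have hφr : Differentiable ℝ fun u => φ (u / r) :=
      (hφ.differentiable one_ne_zero).comp (differentiable_id.div_const r)
    have hφd : DifferentiableAt ℝ (fun y : EuclideanSpace ℝ (Fin n) => φ (‖y‖ / r)) x :=
      (hφr _).comp x (hasFDerivAt_norm_of_ne_zero hx0).differentiableAt
    have hφf := fderiv_comp_norm_single (hφr ‖x‖) hx0 j
    have hdr : deriv (fun u => φ (u / r)) ‖x‖ = deriv φ (‖x‖ / r) / r := by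
      have := ((hφ.differentiable one_ne_zero) (‖x‖ / r)).hasDerivAt.comp ‖x‖
        ((hasDerivAt_id ‖x‖).div_const r)
      simpa [div_eq_mul_inv, Function.comp_def] using this.deriv
    rw [hdr] at hφf
    simp only
    rw [fderiv_fun_mul (hhd.fun_mul hed) hφd, fderiv_fun_mul hhd hed]
    simp only [add_apply, smul_apply, smul_eq_mul, hφf, he]
    field_simp
    ring
  · refine ContinuousOn.integrableOn_compact hK ?_
    exact ((hf.continuousOn_fderiv_of_isOpen hU0 le_rfl).mono hAU0).clm_apply continuousOn_const
  · refine ContinuousOn.integrableOn_compact hK ?_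
    fun_prop (disch := simpa using hne)

theorem sum_interior_terms_eq {n : ℕ} {r : ℝ} (hr : r ≠ 0) {x : EuclideanSpace ℝ (Fin n)}
    (hx : ‖x‖ ≠ 0) (g : Matrix (Fin n) (Fin n) ℝ) (p q : ℝ) :
    (∑ i : Fin n, ∑ j : Fin n,
      (((((n : ℝ) - 2) / ‖x‖) * p + (1 / r) * q) *
          ((if i = j then (1 : ℝ) else 0) * (g i j - if i = j then 1 else 0)) +
        ((1 / ‖x‖) * p - (1 / r) * q) *
          ((g i j - if i = j then 1 else 0) * (x i * x j / ‖x‖ ^ 2)))) =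
      ∑ i : Fin n, ∑ j : Fin n,
        ((g j j - if j = j then 1 else 0) * (q / r * (x i * x i / ‖x‖ ^ 2) +
            p * ((if i = i then 1 else 0) / ‖x‖ - x i * x i / ‖x‖ ^ 3)) -
          (g i j - if i = j then 1 else 0) * (q / r * (x i * x j / ‖x‖ ^ 2) +
            p * ((if i = j then 1 else 0) / ‖x‖ - x i * x j / ‖x‖ ^ 3))) := by
  have hsq : ∑ i, x i * x i = ‖x‖ ^ 2 := by
    rw [EuclideanSpace.norm_sq_eq]
    exact Finset.sum_congr rfl fun i _ => by rw [Real.norm_eq_abs, sq_abs, sq]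
  have hrow : ∑ i, (q / r * (x i * x i / ‖x‖ ^ 2) + p * (1 / ‖x‖ - x i * x i / ‖x‖ ^ 3)) =
      q / r + p * ((n - 1) / ‖x‖) := by
    simp only [Finset.sum_add_distrib, ← Finset.mul_sum, Finset.sum_sub_distrib,
      ← Finset.sum_div, hsq, Finset.sum_const, Finset.card_univ, Fintype.card_fin, nsmul_eq_mul]
    field_simp
  have hcross : ∑ i : Fin n, ∑ j : Fin n, (g j j - 1) * (q / r * (x i * x i / ‖x‖ ^ 2) +
      p * (1 / ‖x‖ - x i * x i / ‖x‖ ^ 3)) =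
      ∑ i : Fin n, ∑ j : Fin n,
        (if i = j then (q / r + p * ((n - 1) / ‖x‖)) * (g i j - 1) else 0) := by
    rw [Finset.sum_comm]
    simp only [← Finset.mul_sum, hrow, Finset.sum_ite_eq, Finset.mem_univ, if_true]
    rw [← Finset.sum_mul, mul_comm]
  simp only [if_true, Finset.sum_sub_distrib (G := ℝ), hcross]
  simp only [← Finset.sum_sub_distrib]
  refine Finset.sum_congr rfl fun i _ => Finset.sum_congr rfl fun j _ => ?_
  split_ifs <;> field_simp <;> ring

/-- **The `C⁰` local mass of a `C¹` metric equals the weighted average of the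
classical ADM mass integrand.**
Let `n ≥ 2`, `r > 0`, let `g` be a `C¹` Riemannian metric on an open
neighborhood `U` of the closed annulus `Ā(0,.9r,1.1r) ⊆ ℝⁿ`, and let
`φ : ℝ → ℝ` be smooth with `∫_{.9}^{1.1} φ ≠ 0`.  Then
`M_{C⁰}(g,φ,r) = (r ∫_{.9}^{1.1} φ)⁻¹ ∫_{.9r}^{1.1r} φ(u/r)
  (∫_{S(u)} Σ_{i,j} (∂_j g_{ij} - ∂_i g_{jj}) ν^i dS) du`
with `ν(x) = x/|x|`. -/
theorem massC0_eq_average_ADM_integrand (n : ℕ) (hn : 2 ≤ n) (r : ℝ)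
    (hr : 0 < r) (U : Set (EuclideanSpace ℝ (Fin n))) (hU : IsOpen U)
    (hAU : closedAnnulus n (0.9 * r) (1.1 * r) ⊆ U)
    (g : EuclideanSpace ℝ (Fin n) → Matrix (Fin n) (Fin n) ℝ)
    (hg : ∀ i j : Fin n, ContDiffOn ℝ 1 (fun y => g y i j) U)
    (hgsymm : ∀ x ∈ U, (g x).IsSymm)
    (hgpos : ∀ x ∈ U, (g x).PosDef)
    (φ : ℝ → ℝ) (hφ : ContDiff ℝ (⊤ : ℕ∞) φ)
    (hφint : (∫ ℓ in (0.9 : ℝ)..1.1, φ ℓ) ≠ 0) :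
    massC0 n g φ r =
      (r * ∫ ℓ in (0.9 : ℝ)..1.1, φ ℓ)⁻¹ *
        ∫ u in (0.9 * r)..(1.1 * r), φ (u / r) *
          sphereIntegral n u (fun x =>
            ∑ i : Fin n, ∑ j : Fin n,
              (fderiv ℝ (fun y => g y i j) x (EuclideanSpace.single j 1) -
                fderiv ℝ (fun y => g y j j) x (EuclideanSpace.single i 1)) *
                (x i / ‖x‖)) := by
  have hs : 0 < 0.9 * r := by positivity
  have hst : 0.9 * r ≤ 1.1 * r := by nlinarith
  have ht : 0 < 1.1 * r := by positivity
  set s := 0.9 * r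
  set t := 1.1 * r
  set A := closedAnnulus n s t with hA
  have hK : IsCompact A := isCompact_closedAnnulus n s t
  have hAm : MeasurableSet A := measurableSet_closedAnnulus n s t
  have hne : ∀ x ∈ A, ‖x‖ ≠ 0 := fun x hx => (hs.trans_le hx.1).ne'
  have hφ1 : ContDiff ℝ 1 φ := hφ.of_le (by exact_mod_cast le_top)
  have hφc : Continuous φ := hφ.continuous
  have hφ'c : Continuous (deriv φ) := hφ1.continuous_deriv le_rfl
  have hgc : ∀ i j, ContinuousOn (fun x => g x i j) A := fun i j =>
    (hg i j).continuousOn.mono hAU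
  have hdc : ∀ i j k, ContinuousOn (fun x => fderiv ℝ (fun y => g y i j) x
      (EuclideanSpace.single k (1 : ℝ))) A := fun i j k =>
    (((hg i j).continuousOn_fderiv_of_isOpen hU le_rfl).mono hAU).clm_apply continuousOn_const
  set B : Fin n → Fin n → Fin n → Fin n → ℝ → ℝ := fun i j k l u => sphereIntegral n u
    (fun x => (g x i j - if i = j then 1 else 0) * (x k / ‖x‖) * φ (‖x‖ / r) * (x l / ‖x‖)) with hB
  set C : Fin n → Fin n → Fin n → Fin n → EuclideanSpace ℝ (Fin n) → ℝ := fun i j k l x =>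
    (g x i j - if i = j then 1 else 0) * (deriv φ (‖x‖ / r) / r * (x k * x l / ‖x‖ ^ 2) +
      φ (‖x‖ / r) * ((if k = l then 1 else 0) / ‖x‖ - x k * x l / ‖x‖ ^ 3)) with hC
  have hCint : ∀ i j k l, IntegrableOn (C i j k l) A := fun i j k l =>
    ContinuousOn.integrableOn_compact hK (by
      have := hgc i j
      fun_prop (disch := simpa using hne))
  have hparts : ∀ i j k l, ∫ x in A, φ (‖x‖ / r) *
      (fderiv ℝ (fun y => g y i j) x (EuclideanSpace.single l 1) * (x k / ‖x‖)) =
      B i j k l t - B i j k l s - ∫ x in A, C i j k l x := by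
    intro i j k l
    have := setIntegral_radial_mul_fderiv hn hs hst hU hAU
      ((hg i j).sub (contDiffOn_const (c := if i = j then 1 else 0))) hφ1 r k l
    simpa only [fderiv_sub_const] using this
  have hBcont : ∀ u, (∀ x : EuclideanSpace ℝ (Fin n), ‖x‖ = u → x ∈ A) → ∀ i j k l,
      ContinuousOn (fun x => (g x i j - if i = j then 1 else 0) * (x k / ‖x‖) * φ (‖x‖ / r) *
        (x l / ‖x‖)) {x | ‖x‖ = u} := by
    intro u hu i j k l
    have := (hgc i j).mono hu
    have hne' : ∀ x : EuclideanSpace ℝ (Fin n), ‖x‖ = u → ‖x‖ ≠ 0 := fun x hx => hne x (hu x hx)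
    fun_prop (disch := simpa using hne')
  have hst' : ∀ x : EuclideanSpace ℝ (Fin n), ‖x‖ = t → x ∈ A := fun x hx =>
    ⟨hx ▸ hst, hx.le⟩
  have hss' : ∀ x : EuclideanSpace ℝ (Fin n), ‖x‖ = s → x ∈ A := fun x hx =>
    ⟨hx.ge, hx ▸ hst⟩
  have hout : ∀ i j, sphereIntegral n t (fun x =>
      (g x i j - if i = j then 1 else 0) * (x i / ‖x‖) * φ (‖x‖ / r) * (x j / ‖x‖) -
        (g x j j - 1) * (x i / ‖x‖) * φ (‖x‖ / r) * (x i / ‖x‖)) =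
      B i j i j t - B j j i i t := by
    intro i j
    rw [hB, ← sphereIntegral_sub ht.le (hBcont t hst' i j i j) (hBcont t hst' j j i i)]
    simp
  have hin : ∀ i j, sphereIntegral n s (fun x =>
      (g x i j - if i = j then 1 else 0) * (x i / ‖x‖) * φ (‖x‖ / r) * (-(x j) / ‖x‖) -
        (g x j j - 1) * (x i / ‖x‖) * φ (‖x‖ / r) * (-(x i) / ‖x‖)) =
      -(B i j i j s - B j j i i s) := by
    intro i j
    rw [hB, ← sphereIntegral_sub hs.le (hBcont s hss' i j i j) (hBcont s hss' j j i i),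
      ← sphereIntegral_neg]
    refine sphereIntegral_congr hs.le fun x _ => ?_
    rw [if_pos (rfl : j = j)]
    ring
  have hlhs_int : ∀ i j : Fin n, IntegrableOn (fun x : EuclideanSpace ℝ (Fin n) =>
      ((((n : ℝ) - 2) / ‖x‖) * φ (‖x‖ / r) + (1 / r) * deriv φ (‖x‖ / r)) *
          ((if i = j then (1 : ℝ) else 0) * (g x i j - if i = j then 1 else 0)) +
        ((1 / ‖x‖) * φ (‖x‖ / r) - (1 / r) * deriv φ (‖x‖ / r)) *
          ((g x i j - if i = j then 1 else 0) * (x i * x j / ‖x‖ ^ 2))) A := fun i j =>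
    ContinuousOn.integrableOn_compact hK (by
      have := hgc i j
      fun_prop (disch := simpa using hne))
  have hterm : ∀ i j k l, IntegrableOn (fun x : EuclideanSpace ℝ (Fin n) => φ (‖x‖ / r) *
      (fderiv ℝ (fun y => g y i j) x (EuclideanSpace.single l 1) * (x k / ‖x‖))) A :=
    fun i j k l => ContinuousOn.integrableOn_compact hK (by
      have := hdc i j l
      fun_prop (disch := simpa using hne))
  have hrhs : ∫ u in s..t, φ (u / r) * sphereIntegral n u (fun x => ∑ i : Fin n, ∑ j : Fin n,
      (fderiv ℝ (fun y => g y i j) x (EuclideanSpace.single j 1) -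
        fderiv ℝ (fun y => g y j j) x (EuclideanSpace.single i 1)) * (x i / ‖x‖)) =
      ∑ i, ∑ j, ((B i j i j t - B i j i j s - ∫ x in A, C i j i j x) -
        (B j j i i t - B j j i i s - ∫ x in A, C j j i i x)) := by
    simp only [← hparts]
    have e : ∀ i j : Fin n, (∫ x in A, φ (‖x‖ / r) *
          (fderiv ℝ (fun y => g y i j) x (EuclideanSpace.single j 1) * (x i / ‖x‖))) -
        (∫ x in A, φ (‖x‖ / r) *
          (fderiv ℝ (fun y => g y j j) x (EuclideanSpace.single i 1) * (x i / ‖x‖))) =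
        ∫ x in A, (φ (‖x‖ / r) *
          (fderiv ℝ (fun y => g y i j) x (EuclideanSpace.single j 1) * (x i / ‖x‖)) -
          φ (‖x‖ / r) *
          (fderiv ℝ (fun y => g y j j) x (EuclideanSpace.single i 1) * (x i / ‖x‖))) :=
      fun i j => (integral_sub (hterm i j i j) (hterm j j i i)).symm
    simp only [e]
    have hI : ∀ i j : Fin n, IntegrableOn (fun x => φ (‖x‖ / r) *
          (fderiv ℝ (fun y => g y i j) x (EuclideanSpace.single j 1) * (x i / ‖x‖)) -
          φ (‖x‖ / r) *
          (fderiv ℝ (fun y => g y j j) x (EuclideanSpace.single i 1) * (x i / ‖x‖))) A :=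
      fun i j => (hterm i j i j).sub (hterm j j i i)
    simp only [← integral_finsetSum _ fun j (_ : j ∈ Finset.univ) => hI _ j]
    rw [← integral_finsetSum _ fun i _ => integrable_finsetSum _ fun j _ => hI i j,
      setIntegral_closedAnnulus hn hs hst
        (integrable_finsetSum _ fun i _ => integrable_finsetSum _ fun j _ => hI i j)]
    refine intervalIntegral.integral_congr fun u hu => ?_
    rw [Set.uIcc_of_le hst] at hu
    have hu0 : 0 ≤ u := hs.le.trans hu.1
    simp only
    rw [← sphereIntegral_mul_radial hu0 fun v => φ (v / r)]
    refine sphereIntegral_congr hu0 fun x _ => ?_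
    simp only [Finset.mul_sum]
    exact Finset.sum_congr rfl fun i _ => Finset.sum_congr rfl fun j _ => by ring
  have hvol : ∑ i : Fin n, ∑ j : Fin n, ∫ x in A,
      (((((n : ℝ) - 2) / ‖x‖) * φ (‖x‖ / r) + (1 / r) * deriv φ (‖x‖ / r)) *
          ((if i = j then (1 : ℝ) else 0) * (g x i j - if i = j then 1 else 0)) +
        ((1 / ‖x‖) * φ (‖x‖ / r) - (1 / r) * deriv φ (‖x‖ / r)) *
          ((g x i j - if i = j then 1 else 0) * (x i * x j / ‖x‖ ^ 2))) =
      ∑ i, ∑ j, ∫ x in A, (C j j i i x - C i j i j x) := by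
    have hI : ∀ i j : Fin n, IntegrableOn (fun x => C j j i i x - C i j i j x) A :=
      fun i j => (hCint j j i i).sub (hCint i j i j)
    simp only [← integral_finsetSum _ fun j (_ : j ∈ Finset.univ) => hI _ j,
      ← integral_finsetSum _ fun j (_ : j ∈ Finset.univ) => hlhs_int _ j]
    rw [← integral_finsetSum _ fun i _ => integrable_finsetSum _ fun j _ => hI i j,
      ← integral_finsetSum _ fun i _ => integrable_finsetSum _ fun j _ => hlhs_int i j]
    refine setIntegral_congr_fun hAm fun x hx => ?_
    exact sum_interior_terms_eq hr.ne' (hne x hx) (g x) (φ (‖x‖ / r)) (deriv φ (‖x‖ / r))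
  rw [hrhs, massC0, show 0.9 * r = s from rfl, show 1.1 * r = t from rfl]
  congr 1
  simp only [hout, hin, Finset.sum_add_distrib]
  rw [hvol]
  simp only [integral_sub (hCint _ _ _ _) (hCint _ _ _ _), ← Finset.sum_add_distrib]
  exact Finset.sum_congr rfl fun i _ => Finset.sum_congr rfl fun j _ => by ring
end

section
/- For all 0 < δ < 1 and r > 0 the following holds. Let C, D ⊂ ℝ^n be open sets and φ: D → C a C¹ diffeomorphism. Suppose x₀ ∈ D satisfies B(x₀, (1+δ)r) ⊆ D and B(φ(x₀), r) ⊆ C, and φ is locally (1+δ)-bilipschitz on B(x₀, (1+δ)r). Then φ is a 4δr-isometry on B(x₀, r/(1+δ)): for all x, y ∈ B(x₀, r/(1+δ)), | |φ(x) − φ(y)| − |x − y| | ≤ 4δr. -/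
open Metric

/-- If the composite of two maps is locally the identity and the outer one stretches lengths by
at least `K⁻¹` at the relevant point, then the inner one has derivative of norm at most `K`. -/
lemma norm_fderiv_le_of_rightInverse {E F : Type*}
    [NormedAddCommGroup E] [NormedSpace ℝ E] [NormedAddCommGroup F] [NormedSpace ℝ F]
    {φ : E → F} {ψ : F → E} {w : F} {K : ℝ} (hK : 0 < K)
    (hφ : DifferentiableAt ℝ φ (ψ w)) (hψ : DifferentiableAt ℝ ψ w)
    (hright : ∀ᶠ z in nhds w, φ (ψ z) = z)
    (hlow : ∀ v : E, ‖v‖ = 1 → K⁻¹ ≤ ‖fderiv ℝ φ (ψ w) v‖) (v : F) :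
    ‖fderiv ℝ ψ w v‖ ≤ K * ‖v‖ := by
  have hcomp : HasFDerivAt (fun z => φ (ψ z)) ((fderiv ℝ φ (ψ w)).comp (fderiv ℝ ψ w)) w :=
    hφ.hasFDerivAt.comp w hψ.hasFDerivAt
  have hid : HasFDerivAt (fun z => φ (ψ z)) (ContinuousLinearMap.id ℝ F) w :=
    (hasFDerivAt_id w).congr_of_eventuallyEq hright
  have hv : fderiv ℝ φ (ψ w) (fderiv ℝ ψ w v) = v := DFunLike.congr_fun (hcomp.unique hid) v
  set u := fderiv ℝ ψ w v
  rcases eq_or_ne u 0 with hu | hu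
  · rw [hu, norm_zero]
    positivity
  · have hu' : 0 < ‖u‖ := norm_pos_iff.2 hu
    have h := hlow (‖u‖⁻¹ • u) (by rw [norm_smul, norm_inv, norm_norm, inv_mul_cancel₀ hu'.ne'])
    rw [map_smul, hv, norm_smul, norm_inv, norm_norm, inv_mul_eq_div, le_div_iff₀ hu',
      inv_mul_le_iff₀ hK] at h
    exact h

/-- A map whose derivative is bounded by `K` at all points of `B(p, r)` which it sends to
`B(ψ p, K r)` sends all of `B(p, r)` to `B(ψ p, K r)`. -/
lemma mapsTo_ball_of_norm_fderiv_le {E F : Type*}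
    [NormedAddCommGroup E] [NormedSpace ℝ E] [NormedAddCommGroup F] [NormedSpace ℝ F]
    {ψ : F → E} {p : F} {K r : ℝ} (hK : 0 < K)
    (hψ : ∀ w ∈ ball p r, DifferentiableAt ℝ ψ w)
    (hbound : ∀ w ∈ ball p r, ψ w ∈ ball (ψ p) (K * r) → ∀ v, ‖fderiv ℝ ψ w v‖ ≤ K * ‖v‖) :
    Set.MapsTo ψ (ball p r) (ball (ψ p) (K * r)) := by
  intro z hz
  have hzr : K * ‖z - p‖ < K * r := mul_lt_mul_of_pos_left (mem_ball_iff_norm.1 hz) hK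
  obtain ⟨L, hL, hLr⟩ := exists_between hzr
  have hL0 : 0 ≤ L := (by positivity : 0 ≤ K * ‖z - p‖).trans hL.le
  have hmem : ∀ t ∈ Set.Icc (0 : ℝ) 1, p + t • (z - p) ∈ ball p r := by
    intro t ht
    rw [mem_ball_iff_norm, add_sub_cancel_left, norm_smul, Real.norm_of_nonneg ht.1]
    exact (mul_le_of_le_one_left (norm_nonneg _) ht.2).trans_lt (mem_ball_iff_norm.1 hz)
  have hderiv : ∀ t ∈ Set.Icc (0 : ℝ) 1, HasDerivAt (fun s : ℝ => ψ (p + s • (z - p)) - ψ p)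
      (fderiv ℝ ψ (p + t • (z - p)) (z - p)) t := by
    intro t ht
    have hline : HasDerivAt (fun s : ℝ => p + s • (z - p)) (z - p) t := by
      simpa using ((hasDerivAt_id t).smul_const (z - p)).const_add p
    exact ((hψ _ (hmem t ht)).hasFDerivAt.comp_hasDerivAt t hline).sub_const _
  have key := image_norm_le_of_norm_deriv_right_lt_deriv_boundary
    (f := fun s : ℝ => ψ (p + s • (z - p)) - ψ p) (a := 0) (b := 1)
    (f' := fun t => fderiv ℝ ψ (p + t • (z - p)) (z - p))
    (B := fun t => L * t) (B' := fun _ => L)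
    (fun t ht => (hderiv t ht).continuousAt.continuousWithinAt)
    (fun t ht => (hderiv t (Set.Ico_subset_Icc_self ht)).hasDerivWithinAt)
    (by simp)
    (fun t => by simpa using (hasDerivAt_id t).const_mul L)
    (fun t ht heq => by
      have htI := Set.Ico_subset_Icc_self ht
      refine (hbound _ (hmem t htI) ?_ _).trans_lt hL
      rw [mem_ball_iff_norm]
      exact heq.trans_lt ((mul_le_of_le_one_right hL0 htI.2).trans_lt hLr))
    (Set.right_mem_Icc.2 zero_le_one)
  rw [mem_ball_iff_norm]
  exact lt_of_le_of_lt (by simpa using key) hLr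

/-- **A locally `(1+δ)`-bilipschitz diffeomorphism of a ball is a
`4δr`-isometry on a slightly smaller ball.**
Let `0 < δ < 1`, `r > 0`, let `φ : D → C` be a `C¹` diffeomorphism between open
subsets of `ℝⁿ`, and suppose `x₀ ∈ D` satisfies `B(x₀,(1+δ)r) ⊆ D`,
`B(φ(x₀),r) ⊆ C`, and `φ` is locally `(1+δ)`-bilipschitz on `B(x₀,(1+δ)r)`
(i.e. `(1+δ)⁻¹ ≤ ‖d_xφ(v)‖ ≤ 1+δ` for unit vectors `v`).  Then for all
`x, y ∈ B(x₀, r/(1+δ))` one has `| ‖φ(x)-φ(y)‖ - ‖x-y‖ | ≤ 4δr`. -/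
theorem bilipschitz_is_almost_isometry (n : ℕ) (δ r : ℝ)
    (hδ : 0 < δ) (hδ1 : δ < 1) (hr : 0 < r)
    (D C : Set (EuclideanSpace ℝ (Fin n))) (hD : IsOpen D) (hC : IsOpen C)
    (φ ψ : EuclideanSpace ℝ (Fin n) → EuclideanSpace ℝ (Fin n))
    (hφdiff : ContDiffOn ℝ 1 φ D) (hφmaps : φ '' D = C)
    (hψdiff : ContDiffOn ℝ 1 ψ C)
    (hleft : ∀ x ∈ D, ψ (φ x) = x) (hright : ∀ y ∈ C, φ (ψ y) = y)
    (x₀ : EuclideanSpace ℝ (Fin n)) (hx₀ : x₀ ∈ D)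
    (hball : ball x₀ ((1 + δ) * r) ⊆ D)
    (hball' : ball (φ x₀) r ⊆ C)
    (hbilip : ∀ x ∈ ball x₀ ((1 + δ) * r),
      ∀ v : EuclideanSpace ℝ (Fin n), ‖v‖ = 1 →
        (1 + δ)⁻¹ ≤ ‖fderiv ℝ φ x v‖ ∧ ‖fderiv ℝ φ x v‖ ≤ 1 + δ) :
    ∀ x ∈ ball x₀ (r / (1 + δ)), ∀ y ∈ ball x₀ (r / (1 + δ)),
      |‖φ x - φ y‖ - ‖x - y‖| ≤ 4 * δ * r := by
  have hK : 0 < 1 + δ := by linarith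
  have hφd : ∀ x ∈ ball x₀ ((1 + δ) * r), DifferentiableAt ℝ φ x := fun x hx =>
    (hφdiff.differentiableOn one_ne_zero).differentiableAt (hD.mem_nhds (hball hx))
  have hψd : ∀ w ∈ ball (φ x₀) r, DifferentiableAt ℝ ψ w := fun w hw =>
    (hψdiff.differentiableOn one_ne_zero).differentiableAt (hC.mem_nhds (hball' hw))
  have hφlip : ∀ x ∈ ball x₀ ((1 + δ) * r), ∀ y ∈ ball x₀ ((1 + δ) * r),
      ‖φ x - φ y‖ ≤ (1 + δ) * ‖x - y‖ := fun x hx y hy =>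
    (convex_ball _ _).norm_image_sub_le_of_norm_fderiv_le hφd
      (fun z hz => ContinuousLinearMap.opNorm_le_of_unit_norm hK.le
        fun v hv => (hbilip z hz v hv).2) hy hx
  have hψbound : ∀ w ∈ ball (φ x₀) r, ψ w ∈ ball x₀ ((1 + δ) * r) →
      ∀ v, ‖fderiv ℝ ψ w v‖ ≤ (1 + δ) * ‖v‖ := fun w hw hψw =>
    norm_fderiv_le_of_rightInverse hK (hφd _ hψw) (hψd w hw)
      (Filter.eventually_of_mem (hC.mem_nhds (hball' hw)) hright)
      fun v hv => (hbilip _ hψw v hv).1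
  have hψmaps : Set.MapsTo ψ (ball (φ x₀) r) (ball x₀ ((1 + δ) * r)) := by
    have h := mapsTo_ball_of_norm_fderiv_le (ψ := ψ) hK hψd
    rw [hleft x₀ hx₀] at h
    exact h hψbound
  have hψlip : ∀ z ∈ ball (φ x₀) r, ∀ w ∈ ball (φ x₀) r,
      ‖ψ z - ψ w‖ ≤ (1 + δ) * ‖z - w‖ := fun z hz w hw =>
    (convex_ball _ _).norm_image_sub_le_of_norm_fderiv_le hψd
      (fun u hu => ContinuousLinearMap.opNorm_le_bound _ hK.le
        (hψbound u hu (hψmaps hu))) hw hz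
  have hrr : r / (1 + δ) ≤ (1 + δ) * r :=
    (div_le_self hr.le (by linarith)).trans (le_mul_of_one_le_left hr.le (by linarith))
  have hsub := ball_subset_ball (x := x₀) hrr
  have himage : ∀ x ∈ ball x₀ (r / (1 + δ)), φ x ∈ ball (φ x₀) r := by
    intro x hx
    have hx' := mem_ball_iff_norm.1 hx
    rw [lt_div_iff₀' hK] at hx'
    exact mem_ball_iff_norm.2
      ((hφlip x (hsub hx) x₀ (mem_ball_self (by positivity))).trans_lt hx')
  intro x hx y hy
  have hupper := hφlip x (hsub hx) y (hsub hy)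
  have hlower := hψlip _ (himage x hx) _ (himage y hy)
  rw [hleft x (hball (hsub hx)), hleft y (hball (hsub hy))] at hlower
  have hdist : ‖x - y‖ ≤ 2 * r := by
    have h := dist_triangle_right x y x₀
    have hr' : r / (1 + δ) ≤ r := div_le_self hr.le (by linarith)
    rw [dist_eq_norm x y] at h
    linarith [mem_ball.1 hx, mem_ball.1 hy]
  have himdist : ‖φ x - φ y‖ ≤ 2 * r := by
    have h := dist_triangle_right (φ x) (φ y) (φ x₀)
    rw [dist_eq_norm (φ x) (φ y)] at h
    linarith [mem_ball.1 (himage x hx), mem_ball.1 (himage y hy)]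
  have h₁ := mul_le_mul_of_nonneg_left hdist hδ.le
  have h₂ := mul_le_mul_of_nonneg_left himdist hδ.le
  have h₃ : 0 < δ * r := mul_pos hδ hr
  rw [abs_le]
  constructor <;> linarith
end

section
/- There exist c = c(n) and δ̄ = δ̄(n) such that for all 0 < δ < δ̄ and all ρ₀ > 0 the following holds. Let φ: D → C be a C¹ diffeomorphism between open sets C, D ⊂ ℝ^n, and let x₀ ∈ D satisfy B(x₀, 2(1+δ)²ρ₀) ⊆ D and B(φ(x₀), 2(1+δ)ρ₀) ⊆ C. If φ is locally (1+δ)-bilipschitz on B(x₀, 2(1+δ)²ρ₀), then there exists a Euclidean isometry L with L(x₀) = φ(x₀) and ρ₀^{-1} sup_{B(x₀,ρ₀)} |φ_{ρ₀} − L| + sup_{B(x₀,ρ₀)} |dφ_{ρ₀} − dL| ≤ cδ, where φ_{ρ₀} is the mollification of φ at constant scale ρ₀. -/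
open MeasureTheory Metric

/-- The standard mollifier `ζ(z) = c_n exp(-1/(1-|z|²))` for `|z| < 1`, `0`
otherwise, normalized so that `∫ ζ = 1`. -/
noncomputable def stdMollifier (n : ℕ) (z : EuclideanSpace ℝ (Fin n)) : ℝ :=
  (∫ w : EuclideanSpace ℝ (Fin n),
      if ‖w‖ < 1 then Real.exp (-1 / (1 - ‖w‖ ^ 2)) else 0)⁻¹ *
    (if ‖z‖ < 1 then Real.exp (-1 / (1 - ‖z‖ ^ 2)) else 0)

/-- A linear map that almost preserves squared norms is close to a linear isometry. -/
theorem LinearMap.exists_linearIsometry_norm_sub_le {E : Type*} [NormedAddCommGroup E]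
    [InnerProductSpace ℝ E] [FiniteDimensional ℝ E] (T : E →ₗ[ℝ] E) {η : ℝ} (hη : η < 1)
    (hT : ∀ x, |‖T x‖ ^ 2 - ‖x‖ ^ 2| ≤ η * ‖x‖ ^ 2) :
    ∃ O : E →ₗᵢ[ℝ] E, ∀ x, ‖T x - O x‖ ≤ Module.finrank ℝ E * η * ‖x‖ := by
  have hS := LinearMap.isSymmetric_adjoint_mul_self T
  set b := hS.eigenvectorBasis rfl
  have hnorm (i) : ‖b i‖ = 1 := b.orthonormal.1 i
  have hs (i) : |‖T (b i)‖ ^ 2 - 1| ≤ η := by simpa [hnorm i] using hT (b i)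
  have hpos (i) : 0 < ‖T (b i)‖ := by
    rcases (norm_nonneg (T (b i))).eq_or_lt with h | h
    · have := (abs_le.1 (hs i)).1
      rw [← h] at this
      linarith
    · exact h
  have horth (i j) : inner ℝ (T (b i)) (T (b j)) = hS.eigenvalues rfl j * inner ℝ (b i) (b j) := by
    rw [← LinearMap.adjoint_inner_right]
    have := hS.apply_eigenvectorBasis rfl j
    rw [Module.End.mul_apply] at this
    rw [this]
    exact inner_smul_right _ _ _
  have hu : Orthonormal ℝ (fun i ↦ ‖T (b i)‖⁻¹ • T (b i)) := by
    refine ⟨fun i ↦ ?_, fun i j hij ↦ ?_⟩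
    · rw [norm_smul, norm_inv, norm_norm, inv_mul_cancel₀ (hpos i).ne']
    · simp only [inner_smul_left, inner_smul_right, horth, b.orthonormal.2 hij, mul_zero]
  set A : E →ₗ[ℝ] E := b.toBasis.constr ℝ (fun i ↦ ‖T (b i)‖⁻¹ • T (b i))
  have hA (i) : A (b i) = ‖T (b i)‖⁻¹ • T (b i) := by
    rw [← b.coe_toBasis]
    exact b.toBasis.constr_basis ℝ _ i
  have hAo : Orthonormal ℝ (A ∘ b.toBasis) := by
    convert hu using 1
    ext1 i
    simp [hA]
  have hbo : Orthonormal ℝ b.toBasis := b.coe_toBasis.symm ▸ b.orthonormal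
  refine ⟨A.isometryOfOrthonormal hbo hAo, fun x ↦ ?_⟩
  rw [LinearMap.coe_isometryOfOrthonormal]
  have hdiff (i) : ‖(T - A) (b i)‖ ≤ η := by
    have h1 : (T - A) (b i) = (1 - ‖T (b i)‖⁻¹) • T (b i) := by
      rw [LinearMap.sub_apply, hA, sub_smul, one_smul]
    have h2 : ‖(T - A) (b i)‖ = |‖T (b i)‖ - 1| := by
      rw [h1, norm_smul, Real.norm_eq_abs, ← abs_of_pos (hpos i), ← abs_mul, abs_of_pos (hpos i),
        sub_mul, inv_mul_cancel₀ (hpos i).ne', one_mul]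
    have h3 : |‖T (b i)‖ ^ 2 - 1| = |‖T (b i)‖ - 1| * (‖T (b i)‖ + 1) := by
      conv_rhs => rw [← abs_of_pos (show 0 < ‖T (b i)‖ + 1 by have := hpos i; linarith), ← abs_mul]
      congr 1
      ring
    have := hs i
    rw [h2]
    nlinarith [abs_nonneg (‖T (b i)‖ - 1), hpos i]
  rw [← LinearMap.sub_apply]
  conv_lhs => rw [← b.sum_repr' x, map_sum]
  calc _ ≤ ∑ i, ‖(T - A) (inner ℝ (b i) x • b i)‖ := norm_sum_le _ _
    _ ≤ ∑ _i : Fin (Module.finrank ℝ E), η * ‖x‖ := by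
        refine Finset.sum_le_sum fun i _ ↦ ?_
        rw [map_smul, norm_smul, mul_comm η]
        refine mul_le_mul ?_ (hdiff i) (norm_nonneg _) (norm_nonneg _)
        simpa [hnorm i] using norm_inner_le_norm (𝕜 := ℝ) (b i) x
    _ = _ := by simp [mul_assoc]

/-- A map that almost preserves inner products on a set containing an orthonormal basis is
uniformly close on this set to a linear isometry. -/
theorem exists_linearIsometry_near_of_abs_inner_sub_inner_le {E ι : Type*} [NormedAddCommGroup E]
    [InnerProductSpace ℝ E] [FiniteDimensional ℝ E] [Fintype ι] (b : OrthonormalBasis ι ℝ E)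
    {S : Set E} (hbS : ∀ i, b i ∈ S) {g : E → E} {ε R : ℝ} (hR : ∀ x ∈ S, ‖g x‖ ≤ R)
    (hε : (Fintype.card ι : ℝ) ^ 2 * ε < 1)
    (hg : ∀ x ∈ S, ∀ y ∈ S, |inner ℝ (g x) (g y) - inner ℝ x y| ≤ ε) :
    ∃ O : E →ₗᵢ[ℝ] E, ∀ x ∈ S,
      ‖g x - O x‖ ≤ Fintype.card ι * (1 + (Fintype.card ι : ℝ) ^ 3 * R) * ε := by
  have hnorm (i) : ‖b i‖ = 1 := b.orthonormal.1 i
  have hcoord (i) (x : E) : |inner ℝ (b i) x| ≤ ‖x‖ := by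
    simpa [hnorm i] using norm_inner_le_norm (𝕜 := ℝ) (b i) x
  set T : E →ₗ[ℝ] E := b.toBasis.constr ℝ (fun i ↦ g (b i))
  have hTb (i) : T (b i) = g (b i) := by
    rw [← b.coe_toBasis]
    exact b.toBasis.constr_basis ℝ _ i
  have hT (x) : |‖T x‖ ^ 2 - ‖x‖ ^ 2| ≤ (Fintype.card ι : ℝ) ^ 2 * ε * ‖x‖ ^ 2 := by
    have hTx : T x = ∑ i, inner ℝ (b i) x • g (b i) := by
      conv_lhs => rw [← b.sum_repr' x, map_sum]
      simp [hTb]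
    have h1 : ‖T x‖ ^ 2 - ‖x‖ ^ 2 = ∑ i, ∑ j, inner ℝ (b i) x * (inner ℝ (b j) x *
        (inner ℝ (g (b i)) (g (b j)) - inner ℝ (b i) (b j))) := by
      have h2 : ‖x‖ ^ 2 = ∑ i, ∑ j, inner ℝ (b i) x * (inner ℝ (b j) x *
          inner ℝ (b i) (b j)) := by
        rw [← real_inner_self_eq_norm_sq]
        conv_lhs => rw [← b.sum_repr' x]
        simp only [sum_inner, inner_sum, inner_smul_left, inner_smul_right, Finset.mul_sum]
        exact Finset.sum_congr rfl fun i _ ↦ Finset.sum_congr rfl fun j _ ↦ by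
          simp [real_inner_comm (b i) (b j)]
      have h3 : ‖T x‖ ^ 2 = ∑ i, ∑ j, inner ℝ (b i) x * (inner ℝ (b j) x *
          inner ℝ (g (b i)) (g (b j))) := by
        rw [← real_inner_self_eq_norm_sq, hTx]
        simp only [sum_inner, inner_sum, inner_smul_left, inner_smul_right, Finset.mul_sum]
        exact Finset.sum_congr rfl fun i _ ↦ Finset.sum_congr rfl fun j _ ↦ by
          simp [real_inner_comm (g (b i)) (g (b j))]
      rw [h2, h3]
      simp only [← Finset.sum_sub_distrib, ← mul_sub]
    rw [h1]
    calc _ ≤ ∑ i : ι, ∑ j : ι, ‖x‖ * (‖x‖ * ε) := by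
          refine (Finset.abs_sum_le_sum_abs _ _).trans (Finset.sum_le_sum fun i _ ↦ ?_)
          refine (Finset.abs_sum_le_sum_abs _ _).trans (Finset.sum_le_sum fun j _ ↦ ?_)
          rw [abs_mul, abs_mul]
          have := hg _ (hbS i) _ (hbS j)
          have h4 := hcoord i x
          have h5 := hcoord j x
          gcongr
      _ = _ := by simp; ring
  obtain ⟨O, hO⟩ := T.exists_linearIsometry_norm_sub_le hε hT
  have hcard : Module.finrank ℝ E = Fintype.card ι := Module.finrank_eq_card_basis b.toBasis
  refine ⟨O, fun x hx ↦ ?_⟩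
  let b' := b.map (O.toLinearIsometryEquiv rfl)
  have hb' (i) : b' i = O (b i) := by simp [b']
  have hb'n (i) : ‖b' i‖ = 1 := b'.orthonormal.1 i
  have hterm (i) : |inner ℝ (b' i) (g x - O x)| ≤ (1 + (Fintype.card ι : ℝ) ^ 3 * R) * ε := by
    have h1 : inner ℝ (b' i) (g x - O x) = (inner ℝ (g (b i)) (g x) - inner ℝ (b i) x)
        - inner ℝ (T (b i) - O (b i)) (g x) := by
      rw [hb', inner_sub_right, inner_sub_left, O.inner_map_map, hTb]
      ring
    have h2 := hO (b i)
    rw [hnorm, hcard] at h2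
    have h3 : |inner ℝ (T (b i) - O (b i)) (g x)| ≤
        (Fintype.card ι * ((Fintype.card ι : ℝ) ^ 2 * ε) * 1) * R :=
      (abs_real_inner_le_norm _ _).trans
        (mul_le_mul h2 (hR x hx) (norm_nonneg _) ((norm_nonneg _).trans h2))
    rw [h1]
    refine (abs_sub _ _).trans ?_
    have := hg _ (hbS i) x hx
    linarith
  rw [← b'.sum_repr' (g x - O x)]
  refine (norm_sum_le _ _).trans ((Finset.sum_le_sum fun i _ ↦ ?_).trans_eq
    (b := ∑ _i : ι, (1 + (Fintype.card ι : ℝ) ^ 3 * R) * ε) ?_)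
  · rw [norm_smul, hb'n, mul_one]
    exact hterm i
  · simp [mul_assoc]

theorem ite_exp_eq_expNegInvGlue {E : Type*} [NormedAddCommGroup E] (z : E) :
    (if ‖z‖ < 1 then Real.exp (-1 / (1 - ‖z‖ ^ 2)) else 0) = expNegInvGlue (1 - ‖z‖ ^ 2) := by
  unfold expNegInvGlue
  have h0 := norm_nonneg z
  by_cases h : ‖z‖ < 1
  · rw [if_pos h, if_neg (by nlinarith), neg_div, one_div]
  · rw [if_neg h, if_pos (by nlinarith)]

theorem contDiff_stdMollifier (n : ℕ) : ContDiff ℝ 1 (stdMollifier n) := by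
  unfold stdMollifier
  simp only [ite_exp_eq_expNegInvGlue]
  exact contDiff_const.mul ((expNegInvGlue.contDiff (n := 1)).comp
    (contDiff_const.sub (contDiff_norm_sq ℝ)))

theorem stdMollifier_eq_zero {n : ℕ} {z : EuclideanSpace ℝ (Fin n)} (hz : 1 ≤ ‖z‖) :
    stdMollifier n z = 0 := by
  simp [stdMollifier, hz.not_gt]

theorem stdMollifier_neg (n : ℕ) (z : EuclideanSpace ℝ (Fin n)) :
    stdMollifier n (-z) = stdMollifier n z := by
  simp [stdMollifier]

theorem hasCompactSupport_of_eq_zero_of_one_le_norm {E : Type*} [NormedAddCommGroup E]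
    [ProperSpace E] {f : E → ℝ} (hf : ∀ z, 1 ≤ ‖z‖ → f z = 0) : HasCompactSupport f :=
  HasCompactSupport.intro (isCompact_closedBall 0 1) fun z hz ↦
    hf z (by simpa using (not_le.1 (by simpa using hz : ¬ ‖z‖ ≤ 1)).le)

theorem hasCompactSupport_stdMollifier (n : ℕ) : HasCompactSupport (stdMollifier n) :=
  hasCompactSupport_of_eq_zero_of_one_le_norm fun _ ↦ stdMollifier_eq_zero

theorem integral_ite_exp_pos (n : ℕ) : 0 < ∫ w : EuclideanSpace ℝ (Fin n),
    if ‖w‖ < 1 then Real.exp (-1 / (1 - ‖w‖ ^ 2)) else 0 := by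
  refine Continuous.integral_pos_of_hasCompactSupport_nonneg_nonzero (x := 0) ?_ ?_ ?_ ?_
  · simp only [ite_exp_eq_expNegInvGlue]
    exact (expNegInvGlue.contDiff (n := 0)).continuous.comp (by fun_prop)
  · exact hasCompactSupport_of_eq_zero_of_one_le_norm fun z hz ↦ if_neg hz.not_gt
  · intro z
    dsimp only
    split_ifs <;> simp [Real.exp_nonneg]
  · simp [Real.exp_ne_zero]

theorem stdMollifier_nonneg (n : ℕ) (z : EuclideanSpace ℝ (Fin n)) : 0 ≤ stdMollifier n z := by
  unfold stdMollifier
  refine mul_nonneg (inv_nonneg.2 (integral_ite_exp_pos n).le) ?_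
  split_ifs <;> simp [Real.exp_nonneg]

theorem integral_stdMollifier (n : ℕ) : ∫ z, stdMollifier n z = 1 := by
  unfold stdMollifier
  rw [integral_const_mul]
  exact inv_mul_cancel₀ (integral_ite_exp_pos n).ne'

theorem integrable_stdMollifier (n : ℕ) : Integrable (stdMollifier n) :=
  (contDiff_stdMollifier n).continuous.integrable_of_hasCompactSupport
    (hasCompactSupport_stdMollifier n)

theorem integral_stdMollifier_smul_id (n : ℕ) :
    ∫ z : EuclideanSpace ℝ (Fin n), stdMollifier n z • z = 0 := by
  have h := integral_neg_eq_self (fun z : EuclideanSpace ℝ (Fin n) ↦ stdMollifier n z • z) volume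
  simp only [stdMollifier_neg, smul_neg, integral_neg] at h
  refine (smul_eq_zero.1 (?_ : (2 : ℝ) • _ = _)).resolve_left two_ne_zero
  rw [two_smul]
  nth_rw 1 [← h]
  exact neg_add_cancel _

/-- Linear maps are fixed by mollification. -/
theorem integral_stdMollifier_smul_linear (n : ℕ)
    (A : EuclideanSpace ℝ (Fin n) →L[ℝ] EuclideanSpace ℝ (Fin n))
    (x : EuclideanSpace ℝ (Fin n)) :
    Integrable (fun z ↦ stdMollifier n z • A (x - z)) ∧
      ∫ z, stdMollifier n z • A (x - z) = A x := by
  have hi : Integrable fun z : EuclideanSpace ℝ (Fin n) ↦ stdMollifier n z • z :=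
    ((contDiff_stdMollifier n).continuous.smul continuous_id).integrable_of_hasCompactSupport
      ((hasCompactSupport_stdMollifier n).smul_right)
  have heq : (fun z ↦ stdMollifier n z • A (x - z)) =
      fun z ↦ stdMollifier n z • A x - A (stdMollifier n z • z) := by
    ext1 z
    rw [map_sub, smul_sub, map_smul]
  have h1 := (integrable_stdMollifier n).smul_const (A x)
  have h2 := A.integrable_comp hi
  refine ⟨heq ▸ h1.sub h2, ?_⟩
  rw [heq, integral_sub h1 h2, integral_smul_const, integral_stdMollifier, one_smul,
    A.integral_comp_comm hi, integral_stdMollifier_smul_id, map_zero, sub_zero]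

theorem stdMollifier_smul_indicator {n : ℕ} {F : Type*} [NormedAddCommGroup F] [NormedSpace ℝ F]
    (f : EuclideanSpace ℝ (Fin n) → F) {x : EuclideanSpace ℝ (Fin n)} (hx : ‖x‖ < 1)
    (z : EuclideanSpace ℝ (Fin n)) :
    stdMollifier n z • (ball 0 2).indicator f (x - z) = stdMollifier n z • f (x - z) := by
  by_cases hz : ‖z‖ < 1
  · rw [Set.indicator_of_mem]
    rw [mem_ball_zero_iff]
    linarith [norm_sub_le x z]
  · rw [stdMollifier_eq_zero (not_lt.1 hz), zero_smul, zero_smul]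

/-- Mollifying a continuous map that is uniformly `M`-close to a linear map `A` on `ball 0 2`
gives a map that is `C¹`-close to `A` on `ball 0 1`. -/
theorem hasFDerivAt_mollification_near_linear {n : ℕ}
    {g : EuclideanSpace ℝ (Fin n) → EuclideanSpace ℝ (Fin n)} (hg : ContinuousOn g (ball 0 2))
    (A : EuclideanSpace ℝ (Fin n) →L[ℝ] EuclideanSpace ℝ (Fin n)) {M : ℝ}
    (hM : ∀ x ∈ ball 0 2, ‖g x - A x‖ ≤ M) {x : EuclideanSpace ℝ (Fin n)} (hx : ‖x‖ < 1) :
    Integrable (fun z ↦ stdMollifier n z • g (x - z)) ∧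
    ‖(∫ z, stdMollifier n z • g (x - z)) - A x‖ ≤ M ∧
    ∃ G' : EuclideanSpace ℝ (Fin n) →L[ℝ] EuclideanSpace ℝ (Fin n),
      HasFDerivAt (fun w ↦ ∫ z, stdMollifier n z • g (w - z)) G' x ∧
      ‖G' - A‖ ≤ M * ∫ z, ‖fderiv ℝ (stdMollifier n) z‖ := by
  have hM0 : 0 ≤ M := (norm_nonneg _).trans (hM 0 (by simp))
  set F := (ball (0 : EuclideanSpace ℝ (Fin n)) 2).indicator (fun x ↦ g x - A x) with hF
  have hFM (x) : ‖F x‖ ≤ M := by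
    by_cases h : x ∈ ball (0 : EuclideanSpace ℝ (Fin n)) 2
    · rw [hF, Set.indicator_of_mem h]
      exact hM x h
    · rw [hF, Set.indicator_of_notMem h, norm_zero]
      exact hM0
  have hFmeas : AEStronglyMeasurable F volume :=
    (aestronglyMeasurable_indicator_iff isOpen_ball.measurableSet).2
      ((hg.sub A.continuous.continuousOn).aestronglyMeasurable isOpen_ball.measurableSet)
  have hFloc : LocallyIntegrable F volume :=
    (memLp_top_of_bound hFmeas M (.of_forall hFM)).locallyIntegrable le_top
  have hFint (w) : Integrable fun z ↦ stdMollifier n z • F (w - z) := by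
    refine (((integrable_stdMollifier n).mul_const M)).mono'
      ((integrable_stdMollifier n).aestronglyMeasurable.smul
        (hFmeas.comp_quasiMeasurePreserving
          (quasiMeasurePreserving_sub_left volume w))) (.of_forall fun z ↦ ?_)
    rw [norm_smul, Real.norm_of_nonneg (stdMollifier_nonneg n z)]
    exact mul_le_mul_of_nonneg_left (hFM _) (stdMollifier_nonneg n z)
  have hpt {w : EuclideanSpace ℝ (Fin n)} (hw : ‖w‖ < 1) (z) : stdMollifier n z • g (w - z) =
      stdMollifier n z • F (w - z) + stdMollifier n z • A (w - z) := by
    rw [hF, stdMollifier_smul_indicator _ hw, ← smul_add, sub_add_cancel]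
  have hsplit {w : EuclideanSpace ℝ (Fin n)} (hw : ‖w‖ < 1) :
      ∫ z, stdMollifier n z • g (w - z) = (∫ z, stdMollifier n z • F (w - z)) + A w := by
    simp only [hpt hw]
    rw [integral_add (hFint w) (integral_stdMollifier_smul_linear n A w).1,
      (integral_stdMollifier_smul_linear n A w).2]
  refine ⟨?_, ?_, ?_⟩
  · simp only [hpt hx]
    exact (hFint x).add (integral_stdMollifier_smul_linear n A x).1
  · rw [hsplit hx, add_sub_cancel_right]
    refine (norm_integral_le_of_norm_le ((integrable_stdMollifier n).mul_const M)
      (.of_forall fun z ↦ ?_)).trans_eq ?_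
    · rw [norm_smul, Real.norm_of_nonneg (stdMollifier_nonneg n z)]
      exact mul_le_mul_of_nonneg_left (hFM _) (stdMollifier_nonneg n z)
    · rw [integral_mul_const, integral_stdMollifier, one_mul]
  · have hder := (hasCompactSupport_stdMollifier n).hasFDerivAt_convolution_left
      (ContinuousLinearMap.lsmul ℝ ℝ) (contDiff_stdMollifier n) hFloc x
    refine ⟨_, (hder.add A.hasFDerivAt).congr_of_eventuallyEq ?_, ?_⟩
    · filter_upwards [(isOpen_ball (x := (0 : EuclideanSpace ℝ (Fin n)))).mem_nhds
        (mem_ball_zero_iff.2 hx)] with w hw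
      exact hsplit (mem_ball_zero_iff.1 hw)
    · rw [add_sub_cancel_right, convolution, mul_comm]
      refine (norm_integral_le_of_norm_le (((((contDiff_stdMollifier n).continuous_fderiv
        one_ne_zero).integrable_of_hasCompactSupport
        ((hasCompactSupport_stdMollifier n).fderiv ℝ)).norm).mul_const M)
        (.of_forall fun z ↦ ?_)).trans_eq (integral_mul_const _ _)
      refine ContinuousLinearMap.opNorm_le_bound _ (by positivity) fun v ↦ ?_
      rw [ContinuousLinearMap.precompL_apply, ContinuousLinearMap.lsmul_apply, norm_smul]
      have h1 := (fderiv ℝ (stdMollifier n) z).le_opNorm v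
      calc _ ≤ (‖fderiv ℝ (stdMollifier n) z‖ * ‖v‖) * M :=
            mul_le_mul h1 (hFM _) (norm_nonneg _) (by positivity)
        _ = _ := by ring

/-- If `ψ` inverts `φ` and `φ` expands distances infinitesimally by at least `K⁻¹` on
`ball x₀ (K * s)`, then `ψ` is `K`-Lipschitz on `ball (φ x₀) s`. -/
theorem norm_inverse_sub_le_of_le_norm_fderiv {E F : Type*} [NormedAddCommGroup E]
    [NormedSpace ℝ E] [NormedAddCommGroup F] [NormedSpace ℝ F] {D : Set E} {C : Set F}
    (hD : IsOpen D) (hC : IsOpen C) {φ : E → F} {ψ : F → E} (hφ : DifferentiableOn ℝ φ D)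
    (hψ : DifferentiableOn ℝ ψ C) (hψφ : ∀ x ∈ D, ψ (φ x) = x) (hφψ : ∀ y ∈ C, φ (ψ y) = y)
    {x₀ : E} (hx₀ : x₀ ∈ D) {K s : ℝ} (hK : 0 < K) (hsD : ball x₀ (K * s) ⊆ D)
    (hsC : ball (φ x₀) s ⊆ C)
    (hlow : ∀ x ∈ ball x₀ (K * s), ∀ v, K⁻¹ * ‖v‖ ≤ ‖fderiv ℝ φ x v‖)
    {p q : F} (hp : p ∈ ball (φ x₀) s) (hq : q ∈ ball (φ x₀) s) :
    ‖ψ q - ψ p‖ ≤ K * ‖q - p‖ := by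
  have hdiff (y) (hy : y ∈ C) : DifferentiableAt ℝ ψ y := hψ.differentiableAt (hC.mem_nhds hy)
  have hbound (y) (hy : y ∈ C) (hyb : ψ y ∈ ball x₀ (K * s)) (w : F) :
      ‖fderiv ℝ ψ y w‖ ≤ K * ‖w‖ := by
    have h1 : HasFDerivAt (φ ∘ ψ) ((fderiv ℝ φ (ψ y)).comp (fderiv ℝ ψ y)) y :=
      (hφ.differentiableAt (hD.mem_nhds (hsD hyb))).hasFDerivAt.comp y (hdiff y hy).hasFDerivAt
    have h2 : HasFDerivAt (φ ∘ ψ) (ContinuousLinearMap.id ℝ F) y :=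
      (hasFDerivAt_id y).congr_of_eventuallyEq
        (Filter.eventually_of_mem (hC.mem_nhds hy) hφψ)
    have h3 : fderiv ℝ φ (ψ y) (fderiv ℝ ψ y w) = w := DFunLike.congr_fun (h1.unique h2) w
    have h4 := hlow _ hyb (fderiv ℝ ψ y w)
    rwa [h3, inv_mul_le_iff₀ hK] at h4
  have hmem (y) (hy : y ∈ ball (φ x₀) s) : ψ y ∈ ball x₀ (K * s) := by
    have hy' : ‖y - φ x₀‖ < s := mem_ball_iff_norm.1 hy
    obtain ⟨k, hk1, hk2⟩ := exists_between (mul_lt_mul_of_pos_left hy' hK)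
    have hseg (t : ℝ) (ht : t ∈ Set.Icc (0 : ℝ) 1) : φ x₀ + t • (y - φ x₀) ∈ C := by
      refine hsC (mem_ball_iff_norm.2 ?_)
      rw [add_sub_cancel_left, norm_smul, Real.norm_of_nonneg ht.1]
      nlinarith [ht.2, norm_nonneg (y - φ x₀)]
    have hderiv (t : ℝ) (ht : t ∈ Set.Icc (0 : ℝ) 1) :
        HasDerivAt (fun t : ℝ ↦ ψ (φ x₀ + t • (y - φ x₀)) - x₀)
          (fderiv ℝ ψ (φ x₀ + t • (y - φ x₀)) (y - φ x₀)) t := by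
      have h1 : HasDerivAt (fun t : ℝ ↦ φ x₀ + t • (y - φ x₀)) (y - φ x₀) t := by
        simpa using ((hasDerivAt_id t).smul_const (y - φ x₀)).const_add (φ x₀)
      exact ((hdiff _ (hseg t ht)).hasFDerivAt.comp_hasDerivAt t h1).sub_const x₀
    have hk : 0 < k := lt_of_le_of_lt (by positivity) hk1
    have key := image_norm_le_of_norm_deriv_right_lt_deriv_boundary
      (f := fun t : ℝ ↦ ψ (φ x₀ + t • (y - φ x₀)) - x₀) (a := 0) (b := 1)
      (B := fun t ↦ k * t) (B' := fun _ ↦ k)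
      (fun t ht ↦ (hderiv t ht).continuousAt.continuousWithinAt)
      (fun t ht ↦ (hderiv t (Set.Ico_subset_Icc_self ht)).hasDerivWithinAt)
      (by simp [hψφ x₀ hx₀]) (fun t ↦ by simpa using (hasDerivAt_id t).const_mul k)
      (fun t ht hteq ↦ ?_) (Set.right_mem_Icc.2 zero_le_one)
    · rw [mem_ball_iff_norm]
      simp only [one_smul, add_sub_cancel, mul_one] at key
      exact key.trans_lt hk2
    · refine (hbound _ (hseg t (Set.Ico_subset_Icc_self ht)) ?_ _).trans_lt hk1
      rw [mem_ball_iff_norm, hteq]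
      nlinarith [ht.1, ht.2]
  exact (convex_ball (φ x₀) s).norm_image_sub_le_of_norm_fderiv_le (𝕜 := ℝ)
    (fun y hy ↦ hdiff y (hsC hy))
    (fun y hy ↦ ContinuousLinearMap.opNorm_le_bound _ hK.le (hbound y (hsC hy) (hmem y hy))) hp hq

/-- A `(1 + δ)`-bilipschitz map fixing the origin almost preserves inner products on a ball. -/
theorem abs_inner_sub_inner_le_of_bilipschitz {E : Type*} [NormedAddCommGroup E]
    [InnerProductSpace ℝ E] {g : E → E} {δ : ℝ} (hδ0 : 0 < δ) (hδ1 : δ ≤ 1) (hg0 : g 0 = 0)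
    (hup : ∀ x ∈ ball (0 : E) 2, ∀ y ∈ ball (0 : E) 2, ‖g x - g y‖ ≤ (1 + δ) * ‖x - y‖)
    (hlow : ∀ x ∈ ball (0 : E) 2, ∀ y ∈ ball (0 : E) 2, ‖x - y‖ ≤ (1 + δ) * ‖g x - g y‖)
    {x y : E} (hx : x ∈ ball 0 2) (hy : y ∈ ball 0 2) :
    |inner ℝ (g x) (g y) - inner ℝ x y| ≤ 36 * δ := by
  have hsq {a b : ℝ} (ha : 0 ≤ a) (hb : 0 ≤ b) (h1 : a ≤ (1 + δ) * b) (h2 : b ≤ (1 + δ) * a) :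
      |a ^ 2 - b ^ 2| ≤ 3 * δ * b ^ 2 := by
    have h3 : a ^ 2 ≤ ((1 + δ) * b) ^ 2 := pow_le_pow_left₀ ha h1 2
    have h4 : b ^ 2 ≤ ((1 + δ) * a) ^ 2 := pow_le_pow_left₀ hb h2 2
    have h5 : (1 + δ) ^ 2 ≤ 1 + 3 * δ := by nlinarith
    have h6 : a ^ 2 ≤ (1 + 3 * δ) * b ^ 2 := by nlinarith [sq_nonneg b]
    have h7 : b ^ 2 ≤ (1 + 3 * δ) * a ^ 2 := by nlinarith [sq_nonneg a]
    rw [abs_le]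
    constructor
    · by_cases hab : a ^ 2 ≤ b ^ 2
      · nlinarith
      · nlinarith [sq_nonneg b]
    · linarith
  have h0 : (0 : E) ∈ ball (0 : E) 2 := by simp
  have hx1 := hsq (norm_nonneg (g x)) (norm_nonneg x) (by simpa [hg0] using hup x hx 0 h0)
    (by simpa [hg0] using hlow x hx 0 h0)
  have hy1 := hsq (norm_nonneg (g y)) (norm_nonneg y) (by simpa [hg0] using hup y hy 0 h0)
    (by simpa [hg0] using hlow y hy 0 h0)
  have hxy := hsq (norm_nonneg (g x - g y)) (norm_nonneg (x - y)) (hup x hx y hy) (hlow x hx y hy)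
  have hx2 : ‖x‖ < 2 := mem_ball_zero_iff.1 hx
  have hy2 : ‖y‖ < 2 := mem_ball_zero_iff.1 hy
  have hxn : ‖x‖ ^ 2 ≤ 4 := by nlinarith [norm_nonneg x]
  have hyn : ‖y‖ ^ 2 ≤ 4 := by nlinarith [norm_nonneg y]
  have hxyn : ‖x - y‖ ^ 2 ≤ 16 := by nlinarith [norm_nonneg (x - y), norm_sub_le x y]
  have e1 := norm_sub_sq_real (g x) (g y)
  have e2 := norm_sub_sq_real x y
  rw [abs_le] at hx1 hy1 hxy ⊢
  constructor <;> nlinarith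

/-- **A mollified locally bilipschitz diffeomorphism is `C¹`-close to a
Euclidean isometry.**  There exist `c = c(n)` and `δ̄ = δ̄(n)` such that for
all `0 < δ < δ̄` and all `ρ₀ > 0`: if `φ : D → C` is a `C¹` diffeomorphism of
open subsets of `ℝⁿ`, `B(x₀, 2(1+δ)²ρ₀) ⊆ D`, `B(φ(x₀), 2(1+δ)ρ₀) ⊆ C`, and
`φ` is locally `(1+δ)`-bilipschitz on `B(x₀, 2(1+δ)²ρ₀)`, then there is a
Euclidean isometry `L(x) = O x + v` with `L(x₀) = φ(x₀)` and
`ρ₀⁻¹ sup_{B(x₀,ρ₀)} |φ_{ρ₀} - L| + sup_{B(x₀,ρ₀)} |dφ_{ρ₀} - dL| ≤ c δ`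
(the sum of the two suprema being expressed via two independent points). -/
theorem mollified_close_to_isometry_fixed_scale (n : ℕ) :
    ∃ c : ℝ, 0 < c ∧ ∃ δbar : ℝ, 0 < δbar ∧
      ∀ δ ρ₀ : ℝ, 0 < δ → δ < δbar → 0 < ρ₀ →
      ∀ D C : Set (EuclideanSpace ℝ (Fin n)), IsOpen D → IsOpen C →
      ∀ φ ψ : EuclideanSpace ℝ (Fin n) → EuclideanSpace ℝ (Fin n),
        ContDiffOn ℝ 1 φ D → φ '' D = C → ContDiffOn ℝ 1 ψ C →
        (∀ x ∈ D, ψ (φ x) = x) → (∀ y ∈ C, φ (ψ y) = y) →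
      ∀ x₀ ∈ D,
        ball x₀ (2 * (1 + δ) ^ 2 * ρ₀) ⊆ D →
        ball (φ x₀) (2 * (1 + δ) * ρ₀) ⊆ C →
        (∀ x ∈ ball x₀ (2 * (1 + δ) ^ 2 * ρ₀),
          ∀ v : EuclideanSpace ℝ (Fin n), ‖v‖ = 1 →
            (1 + δ)⁻¹ ≤ ‖fderiv ℝ φ x v‖ ∧ ‖fderiv ℝ φ x v‖ ≤ 1 + δ) →
        ∃ (O : EuclideanSpace ℝ (Fin n) →L[ℝ] EuclideanSpace ℝ (Fin n))
          (v : EuclideanSpace ℝ (Fin n)),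
          (∀ z, ‖O z‖ = ‖z‖) ∧
          O x₀ + v = φ x₀ ∧
          ∀ x ∈ ball x₀ ρ₀, ∀ y ∈ ball x₀ ρ₀,
            ρ₀⁻¹ * ‖(∫ z : EuclideanSpace ℝ (Fin n),
                stdMollifier n z • φ (x - ρ₀ • z)) - (O x + v)‖ +
            ‖fderiv ℝ (fun w => ∫ z : EuclideanSpace ℝ (Fin n),
                stdMollifier n z • φ (w - ρ₀ • z)) y - O‖ ≤ c * δ := by
  set N : ℝ := (n : ℝ)
  set I : ℝ := ∫ z, ‖fderiv ℝ (stdMollifier n) z‖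
  have hI : 0 ≤ I := integral_nonneg fun _ ↦ norm_nonneg _
  have hN : 0 ≤ N := n.cast_nonneg
  refine ⟨N * (1 + N ^ 3 * 4) * 36 * (1 + I) + 1, by positivity, 1 / (36 * N ^ 2 + 1),
    by positivity, ?_⟩
  intro δ ρ₀ hδ hδb hρ D C hD hC φ ψ hφ _ hψ hψφ hφψ x₀ hx₀ hball hballC hbil
  rw [lt_div_iff₀ (by positivity)] at hδb
  have hδ1 : δ ≤ 1 := by nlinarith [mul_nonneg hδ.le (sq_nonneg N)]
  have hK : 0 < 1 + δ := by linarith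
  have hdil (x) (hx : x ∈ ball x₀ (2 * (1 + δ) ^ 2 * ρ₀)) (v : EuclideanSpace ℝ (Fin n)) :
      (1 + δ)⁻¹ * ‖v‖ ≤ ‖fderiv ℝ φ x v‖ ∧ ‖fderiv ℝ φ x v‖ ≤ (1 + δ) * ‖v‖ := by
    rcases eq_or_ne v 0 with rfl | hv
    · simp
    have hv' : 0 < ‖v‖ := norm_pos_iff.2 hv
    have h := hbil x hx (‖v‖⁻¹ • v) (norm_smul_inv_norm hv)
    rw [map_smul, norm_smul, norm_inv, norm_norm, inv_mul_eq_div, le_div_iff₀ hv',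
      div_le_iff₀ hv'] at h
    exact h
  have hsub : ball x₀ (2 * ρ₀) ⊆ ball x₀ (2 * (1 + δ) ^ 2 * ρ₀) := by
    refine ball_subset_ball ?_
    have : 1 ≤ (1 + δ) ^ 2 := by nlinarith
    nlinarith
  have hφup (x) (hx : x ∈ ball x₀ (2 * ρ₀)) (y) (hy : y ∈ ball x₀ (2 * ρ₀)) :
      ‖φ x - φ y‖ ≤ (1 + δ) * ‖x - y‖ :=
    (convex_ball x₀ (2 * ρ₀)).norm_image_sub_le_of_norm_fderiv_le (𝕜 := ℝ)
      (fun z hz ↦ (hφ.differentiableOn one_ne_zero).differentiableAt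
        (hD.mem_nhds (hball (hsub hz))))
      (fun z hz ↦ ContinuousLinearMap.opNorm_le_bound _ hK.le fun v ↦ (hdil z (hsub hz) v).2)
      hy hx
  have hφmem (x) (hx : x ∈ ball x₀ (2 * ρ₀)) : φ x ∈ ball (φ x₀) (2 * (1 + δ) * ρ₀) := by
    rw [mem_ball_iff_norm] at hx ⊢
    have := hφup x (mem_ball_iff_norm.2 hx) x₀ (mem_ball_self (by positivity))
    nlinarith
  have hφlow (x) (hx : x ∈ ball x₀ (2 * ρ₀)) (y) (hy : y ∈ ball x₀ (2 * ρ₀)) :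
      ‖x - y‖ ≤ (1 + δ) * ‖φ x - φ y‖ := by
    have hrad : (1 + δ) * (2 * (1 + δ) * ρ₀) = 2 * (1 + δ) ^ 2 * ρ₀ := by ring
    have h := norm_inverse_sub_le_of_le_norm_fderiv hD hC (hφ.differentiableOn one_ne_zero)
      (hψ.differentiableOn one_ne_zero) hψφ hφψ hx₀ hK (hrad ▸ hball) hballC
      (fun z hz v ↦ (hdil z (hrad ▸ hz) v).1) (hφmem y hy) (hφmem x hx)
    rwa [hψφ x (hball (hsub hx)), hψφ y (hball (hsub hy))] at h
  set g : EuclideanSpace ℝ (Fin n) → EuclideanSpace ℝ (Fin n) :=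
    fun x ↦ ρ₀⁻¹ • (φ (x₀ + ρ₀ • x) - φ x₀) with hg
  have hmaps (x) (hx : x ∈ ball (0 : EuclideanSpace ℝ (Fin n)) 2) :
      x₀ + ρ₀ • x ∈ ball x₀ (2 * ρ₀) := by
    rw [mem_ball_zero_iff] at hx
    rw [mem_ball_iff_norm, add_sub_cancel_left, norm_smul, Real.norm_of_nonneg hρ.le]
    nlinarith
  have hgsub (x y) : ‖g x - g y‖ = ρ₀⁻¹ * ‖φ (x₀ + ρ₀ • x) - φ (x₀ + ρ₀ • y)‖ := by
    rw [hg, ← smul_sub, sub_sub_sub_cancel_right, norm_smul, norm_inv, Real.norm_of_nonneg hρ.le]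
  have hdist (x y : EuclideanSpace ℝ (Fin n)) :
      ‖x₀ + ρ₀ • x - (x₀ + ρ₀ • y)‖ = ρ₀ * ‖x - y‖ := by
    rw [add_sub_add_left_eq_sub, ← smul_sub, norm_smul, Real.norm_of_nonneg hρ.le]
  have hgup (x) (hx : x ∈ ball 0 2) (y) (hy : y ∈ ball 0 2) :
      ‖g x - g y‖ ≤ (1 + δ) * ‖x - y‖ := by
    have h := hφup _ (hmaps x hx) _ (hmaps y hy)
    rw [hdist] at h
    rw [hgsub, inv_mul_le_iff₀ hρ]
    linarith
  have hglow (x) (hx : x ∈ ball 0 2) (y) (hy : y ∈ ball 0 2) :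
      ‖x - y‖ ≤ (1 + δ) * ‖g x - g y‖ := by
    have h := hφlow _ (hmaps x hx) _ (hmaps y hy)
    rw [hdist] at h
    rw [hgsub, mul_left_comm, le_inv_mul_iff₀ hρ]
    exact h
  have hg0 : g 0 = 0 := by simp [hg]
  have hgcont : ContinuousOn g (ball 0 2) := by
    have h : ContinuousOn (fun x ↦ φ (x₀ + ρ₀ • x)) (ball 0 2) :=
      hφ.continuousOn.comp (by fun_prop) fun x hx ↦ hball (hsub (hmaps x hx))
    exact (h.sub continuousOn_const).const_smul ρ₀⁻¹
  obtain ⟨O, hO⟩ := exists_linearIsometry_near_of_abs_inner_sub_inner_le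
    (EuclideanSpace.basisFun (Fin n) ℝ) (S := ball 0 2) (g := g) (R := 4) (ε := 36 * δ)
    (fun i ↦ by simp) (fun x hx ↦ by
      have h := hgup x hx 0 (by simp)
      rw [hg0, sub_zero, sub_zero] at h
      rw [mem_ball_zero_iff] at hx
      nlinarith [norm_nonneg x])
    (by rw [Fintype.card_fin]; linarith)
    (fun x hx y hy ↦ abs_inner_sub_inner_le_of_bilipschitz hδ hδ1 hg0 hgup hglow hx hy)
  rw [Fintype.card_fin] at hO
  set M : ℝ := N * (1 + N ^ 3 * 4) * (36 * δ) with hM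
  refine ⟨O.toContinuousLinearMap, φ x₀ - O x₀, O.norm_map, by simp, fun x hx y hy ↦ ?_⟩
  have hscale {w : EuclideanSpace ℝ (Fin n)} (hw : w ∈ ball x₀ ρ₀) :
      ‖ρ₀⁻¹ • (w - x₀)‖ < 1 := by
    rw [norm_smul, norm_inv, Real.norm_of_nonneg hρ.le, inv_mul_lt_iff₀ hρ, mul_one]
    exact mem_ball_iff_norm.1 hw
  have hmoll {w : EuclideanSpace ℝ (Fin n)} (hw : w ∈ ball x₀ ρ₀) :
      ∫ z, stdMollifier n z • φ (w - ρ₀ • z) =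
        φ x₀ + ρ₀ • ∫ z, stdMollifier n z • g (ρ₀⁻¹ • (w - x₀) - z) := by
    have hpt (z) : stdMollifier n z • φ (w - ρ₀ • z) =
        stdMollifier n z • φ x₀ + ρ₀ • (stdMollifier n z • g (ρ₀⁻¹ • (w - x₀) - z)) := by
      have hz : x₀ + ρ₀ • (ρ₀⁻¹ • (w - x₀) - z) = w - ρ₀ • z := by
        rw [smul_sub, smul_inv_smul₀ hρ.ne']
        abel
      rw [hg, smul_comm ρ₀, ← smul_add, smul_inv_smul₀ hρ.ne', hz, add_sub_cancel]
    simp only [hpt]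
    have hint : Integrable fun z ↦ ρ₀ • (stdMollifier n z • g (ρ₀⁻¹ • (w - x₀) - z)) :=
      (hasFDerivAt_mollification_near_linear hgcont O.toContinuousLinearMap hO
        (hscale hw)).1.smul ρ₀
    rw [integral_add ((integrable_stdMollifier n).smul_const _) hint, integral_smul_const,
      integral_stdMollifier, one_smul, integral_smul]
  obtain ⟨-, hval, -⟩ := hasFDerivAt_mollification_near_linear hgcont O.toContinuousLinearMap hO
    (hscale hx)
  obtain ⟨-, -, G', hG', hGO⟩ := hasFDerivAt_mollification_near_linear hgcont
    O.toContinuousLinearMap hO (hscale hy)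
  have hfd : HasFDerivAt (fun w ↦ ∫ z, stdMollifier n z • φ (w - ρ₀ • z)) G' y := by
    have h1 : HasFDerivAt (fun w ↦ ρ₀⁻¹ • (w - x₀))
        (ρ₀⁻¹ • ContinuousLinearMap.id ℝ (EuclideanSpace ℝ (Fin n))) y :=
      ((hasFDerivAt_id y).sub_const x₀).const_smul ρ₀⁻¹
    have h2 := ((hG'.comp y h1).const_smul ρ₀).const_add (φ x₀)
    have h3 : ρ₀ • G'.comp (ρ₀⁻¹ • ContinuousLinearMap.id ℝ (EuclideanSpace ℝ (Fin n))) = G' := by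
      rw [ContinuousLinearMap.comp_smul, ContinuousLinearMap.comp_id, smul_inv_smul₀ hρ.ne']
    rw [h3] at h2
    exact h2.congr_of_eventuallyEq
      (Filter.eventually_of_mem (isOpen_ball.mem_nhds hy) fun w hw ↦ hmoll hw)
  have hsup : ρ₀⁻¹ * ‖(∫ z, stdMollifier n z • φ (x - ρ₀ • z)) -
      (O.toContinuousLinearMap x + (φ x₀ - O x₀))‖ ≤ M := by
    have heq : (∫ z, stdMollifier n z • φ (x - ρ₀ • z)) -
        (O.toContinuousLinearMap x + (φ x₀ - O x₀)) =
        ρ₀ • ((∫ z, stdMollifier n z • g (ρ₀⁻¹ • (x - x₀) - z)) -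
          O.toContinuousLinearMap (ρ₀⁻¹ • (x - x₀))) := by
      rw [hmoll hx, smul_sub ρ₀, map_smul, smul_inv_smul₀ hρ.ne', map_sub]
      simp only [LinearIsometry.coe_toContinuousLinearMap]
      abel
    rw [heq, norm_smul, Real.norm_of_nonneg hρ.le, inv_mul_cancel_left₀ hρ.ne']
    exact hval
  rw [hfd.fderiv]
  calc _ ≤ M + M * I := add_le_add hsup hGO
    _ ≤ _ := by rw [hM]; linarith
end

section
/- Let 0 ≤ δ < 1/2 and let φ: D → C be a C¹ diffeomorphism between open subsets of ℝ^n such that for every x ∈ D and every unit vector v, 1−δ ≤ |d_xφ(v)| ≤ 1+δ. If x, y ∈ D are such that the line segment from x to y is contained in D and the line segment from φ(x) to φ(y) is contained in C, then (1+2δ)^{-1} |x − y| ≤ |φ(x) − φ(y)| ≤ (1+2δ) |x − y|. -/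
/-- Two-sided bounds for a linear map on unit vectors extend homogeneously to all vectors. -/
theorem ContinuousLinearMap.norm_apply_bounds_of_unit {E F : Type*}
    [NormedAddCommGroup E] [NormedSpace ℝ E] [NormedAddCommGroup F] [NormedSpace ℝ F]
    (A : E →L[ℝ] F) {a b : ℝ} (h : ∀ v : E, ‖v‖ = 1 → a ≤ ‖A v‖ ∧ ‖A v‖ ≤ b) (v : E) :
    a * ‖v‖ ≤ ‖A v‖ ∧ ‖A v‖ ≤ b * ‖v‖ := by
  rcases eq_or_ne v 0 with rfl | hv
  · simp
  have hpos : 0 < ‖v‖ := norm_pos_iff.mpr hv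
  have hunit := h (‖v‖⁻¹ • v) (norm_smul_inv_norm (𝕜 := ℝ) hv)
  rwa [map_smul, norm_smul, norm_inv, norm_norm, le_inv_mul_iff₀' hpos,
    inv_mul_le_iff₀' hpos] at hunit

/-- **Global bilipschitz bounds from local ones along segments.**
Let `0 ≤ δ < 1/2` and let `φ : D → C` be a `C¹` diffeomorphism between open
subsets of `ℝⁿ` with `1-δ ≤ ‖d_xφ(v)‖ ≤ 1+δ` for every `x ∈ D` and every unit
vector `v`.  If `x, y ∈ D`, the segment `[x,y]` lies in `D`, and the segment
`[φ(x),φ(y)]` lies in `C`, then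
`(1+2δ)⁻¹ ‖x-y‖ ≤ ‖φ(x)-φ(y)‖ ≤ (1+2δ) ‖x-y‖`. -/
theorem locally_bilipschitz_segment_estimate (n : ℕ) (δ : ℝ)
    (hδ0 : 0 ≤ δ) (hδ : δ < 1 / 2)
    (D C : Set (EuclideanSpace ℝ (Fin n))) (hD : IsOpen D) (hC : IsOpen C)
    (φ ψ : EuclideanSpace ℝ (Fin n) → EuclideanSpace ℝ (Fin n))
    (hφdiff : ContDiffOn ℝ 1 φ D) (hφmaps : φ '' D = C)
    (hψdiff : ContDiffOn ℝ 1 ψ C)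
    (hleft : ∀ x ∈ D, ψ (φ x) = x) (hright : ∀ y ∈ C, φ (ψ y) = y)
    (hbilip : ∀ x ∈ D, ∀ v : EuclideanSpace ℝ (Fin n), ‖v‖ = 1 →
      1 - δ ≤ ‖fderiv ℝ φ x v‖ ∧ ‖fderiv ℝ φ x v‖ ≤ 1 + δ)
    (x y : EuclideanSpace ℝ (Fin n)) (hx : x ∈ D) (hy : y ∈ D)
    (hseg : segment ℝ x y ⊆ D) (hseg' : segment ℝ (φ x) (φ y) ⊆ C) :
    (1 + 2 * δ)⁻¹ * ‖x - y‖ ≤ ‖φ x - φ y‖ ∧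
      ‖φ x - φ y‖ ≤ (1 + 2 * δ) * ‖x - y‖ := by
  have norm_fderiv_apply : ∀ z ∈ D, ∀ v,
      (1 - δ) * ‖v‖ ≤ ‖fderiv ℝ φ z v‖ ∧ ‖fderiv ℝ φ z v‖ ≤ (1 + δ) * ‖v‖ :=
    fun z hz => (fderiv ℝ φ z).norm_apply_bounds_of_unit (hbilip z hz)
  have hφat : ∀ z ∈ D, DifferentiableAt ℝ φ z := fun z hz =>
    (hφdiff.contDiffAt (hD.mem_nhds hz)).differentiableAt one_ne_zero
  have hψat : ∀ w ∈ C, DifferentiableAt ℝ ψ w := fun w hw =>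
    (hψdiff.contDiffAt (hC.mem_nhds hw)).differentiableAt one_ne_zero
  have hψmaps : ∀ w ∈ C, ψ w ∈ D := by
    rw [← hφmaps]
    rintro _ ⟨z, hz, rfl⟩
    rwa [hleft z hz]
  have hψbound : ∀ w ∈ C, ‖fderiv ℝ ψ w‖ ≤ 1 + 2 * δ := by
    intro w hw
    refine ContinuousLinearMap.opNorm_le_bound _ (by linarith) fun v => ?_
    have hcomp : HasFDerivAt (φ ∘ ψ) ((fderiv ℝ φ (ψ w)).comp (fderiv ℝ ψ w)) w :=
      (hφat _ (hψmaps w hw)).hasFDerivAt.comp w (hψat w hw).hasFDerivAt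
    have hid : HasFDerivAt (φ ∘ ψ) (ContinuousLinearMap.id ℝ _) w :=
      (hasFDerivAt_id w).congr_of_eventuallyEq
        (Filter.eventually_of_mem (hC.mem_nhds hw) hright)
    have hv : fderiv ℝ φ (ψ w) (fderiv ℝ ψ w v) = v :=
      DFunLike.congr_fun (hcomp.unique hid) v
    have hlower := (norm_fderiv_apply _ (hψmaps w hw) (fderiv ℝ ψ w v)).1
    rw [hv] at hlower
    have hfactor : 1 ≤ (1 + 2 * δ) * (1 - δ) := by nlinarith
    calc ‖fderiv ℝ ψ w v‖ ≤ (1 + 2 * δ) * (1 - δ) * ‖fderiv ℝ ψ w v‖ :=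
          le_mul_of_one_le_left (norm_nonneg _) hfactor
      _ = (1 + 2 * δ) * ((1 - δ) * ‖fderiv ℝ ψ w v‖) := mul_assoc _ _ _
      _ ≤ (1 + 2 * δ) * ‖v‖ := by gcongr
  constructor
  · rw [inv_mul_le_iff₀ (by linarith)]
    have h := (convex_segment (φ x) (φ y)).norm_image_sub_le_of_norm_fderiv_le
      (fun w hw => hψat w (hseg' hw)) (fun w hw => hψbound w (hseg' hw))
      (right_mem_segment ℝ (φ x) (φ y)) (left_mem_segment ℝ (φ x) (φ y))
    rwa [hleft x hx, hleft y hy] at h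
  · refine (convex_segment x y).norm_image_sub_le_of_norm_fderiv_le
      (fun z hz => hφat z (hseg hz)) (fun z hz => ?_)
      (right_mem_segment ℝ x y) (left_mem_segment ℝ x y)
    refine ContinuousLinearMap.opNorm_le_bound _ (by linarith) fun v => ?_
    refine (norm_fderiv_apply z (hseg hz) v).2.trans ?_
    gcongr
    linarith
end

section
/- Let r̄ > 0, c > 0, ω > 0 and let a: (r̄, ∞) → ℝ be a function such that for all r > r̄ and all r' ∈ [(1.1/.9) r, 10 r], a(r') ≥ a(r) − c r^{−ω}. Then the limit lim_{r→∞} a(r) exists and is either a finite real number or +∞. -/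
open Filter Topology

/-- A real function along a filter that eventually dominates each of its earlier values
converges to a real number or tends to `+∞`. -/
theorem tendsto_nhds_or_atTop_of_eventually_le {ι : Type*} {l : Filter ι} {b : ι → ℝ} {s : Set ι}
    (hs : s ∈ l) (hne : s.Nonempty) (h : ∀ x ∈ s, ∀ᶠ y in l, b x ≤ b y) :
    (∃ L : ℝ, Tendsto b l (𝓝 L)) ∨ Tendsto b l atTop := by
  by_cases hb : BddAbove (b '' s)
  · refine .inl ⟨sSup (b '' s), tendsto_order.2 ⟨fun u hu => ?_, fun u hu => ?_⟩⟩
    · obtain ⟨_, ⟨x, hx, rfl⟩, hux⟩ := exists_lt_of_lt_csSup (hne.image b) hu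
      filter_upwards [h x hx] with y hy using hux.trans_le hy
    · filter_upwards [hs] with y hy using
        (le_csSup hb (Set.mem_image_of_mem b hy)).trans_lt hu
  · refine .inr (tendsto_atTop.2 fun M => ?_)
    obtain ⟨_, ⟨x, hx, rfl⟩, hMx⟩ := not_bddAbove_iff.1 hb M
    filter_upwards [h x hx] with y hy using hMx.le.trans hy

/-- Monotonicity over the window `[(1.1/.9) r, 10 r]` propagates to all larger radii. -/
theorem le_of_le_on_window {R : ℝ} (hR : 0 < R) {b : ℝ → ℝ}
    (hb : ∀ r > R, ∀ r' : ℝ, (1.1 / 0.9) * r ≤ r' → r' ≤ 10 * r → b r ≤ b r')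
    {r r' : ℝ} (hr : R < r) (hr' : (1.1 / 0.9) * r ≤ r') : b r ≤ b r' := by
  have key : ∀ n : ℕ, ∀ t : ℝ, (1.1 / 0.9) * r ≤ t → t ≤ 10 * 5 ^ n * r → b r ≤ b t := by
    intro n
    induction n with
    | zero => exact fun t h₁ h₂ => hb r hr t h₁ (by linarith)
    | succ n ih =>
      intro t h₁ h₂
      rcases le_total t (10 * r) with h | h
      · exact hb r hr t h₁ h
      · refine (ih (t / 5) (by norm_num; linarith) ?_).trans
          (hb (t / 5) (by linarith) t (by norm_num; linarith) (by linarith))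
        rw [pow_succ] at h₂
        linarith
  obtain ⟨n, hn⟩ := pow_unbounded_of_one_lt (r' / (10 * r)) (by norm_num : (1 : ℝ) < 5)
  rw [div_lt_iff₀ (by linarith)] at hn
  exact key n r' hr' (by linarith)


/-- **Almost-monotone functions of a radius have a limit at infinity.**
If `a : (r̄,∞) → ℝ` satisfies `a r' ≥ a r - c r^{-ω}` for all `r > r̄` and all
`r' ∈ [(1.1/.9) r, 10 r]`, then `lim_{r→∞} a r` exists and is either a finite
real number or `+∞`. -/
theorem almost_monotone_radial_limit (rbar c ω : ℝ) (hrbar : 0 < rbar)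
    (hc : 0 < c) (hω : 0 < ω) (a : ℝ → ℝ)
    (ha : ∀ r > rbar, ∀ r' : ℝ, (1.1 / 0.9) * r ≤ r' → r' ≤ 10 * r →
      a r' ≥ a r - c * r ^ (-ω)) :
    (∃ L : ℝ, Filter.Tendsto a Filter.atTop (nhds L)) ∨
      Filter.Tendsto a Filter.atTop Filter.atTop := by
  set q : ℝ := (1.1 / 0.9) ^ (-ω) with hq
  have hq1 : q < 1 := Real.rpow_lt_one_of_one_lt_of_neg (by norm_num) (neg_lt_zero.2 hω)
  set K : ℝ := c / (1 - q) with hK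
  have hK0 : 0 < K := div_pos hc (sub_pos.2 hq1)
  have hKc : K * (1 - q) = c := div_mul_cancel₀ _ (sub_pos.2 hq1).ne'
  -- Subtracting this multiple of `r ^ (-ω)` absorbs the error term.
  set b : ℝ → ℝ := fun r => a r - K * r ^ (-ω) with hb
  have hwindow : ∀ r > rbar, ∀ r' : ℝ, (1.1 / 0.9) * r ≤ r' → r' ≤ 10 * r → b r ≤ b r' := by
    intro r hr r' h₁ h₂
    have hr0 : 0 < r := hrbar.trans hr
    have hpow : r' ^ (-ω) ≤ q * r ^ (-ω) := by
      rw [hq, ← Real.mul_rpow (by norm_num) hr0.le]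
      exact Real.rpow_le_rpow_of_nonpos (by positivity) h₁ (neg_nonpos.2 hω.le)
    have hmul := mul_le_mul_of_nonneg_left hpow hK0.le
    have ha' := ha r hr r' h₁ h₂
    rw [← hKc] at ha'
    simp only [hb]
    linarith
  have herr : Tendsto (fun r : ℝ => K * r ^ (-ω)) atTop (𝓝 0) := by
    simpa using (tendsto_rpow_neg_atTop hω).const_mul K
  have hab : a = fun r => b r + K * r ^ (-ω) := by
    funext r
    simp [hb]
  rcases tendsto_nhds_or_atTop_of_eventually_le (Ioi_mem_atTop rbar) Set.nonempty_Ioi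
    (fun r hr => (eventually_ge_atTop ((1.1 / 0.9) * r)).mono
      fun r' hr' => le_of_le_on_window hrbar hwindow hr hr') with ⟨L, hL⟩ | hL
  · refine .inl ⟨L, ?_⟩
    rw [hab]
    simpa using hL.add herr
  · right
    rw [hab]
    exact hL.atTop_add herr
end

section
/- Let r̄ > 0, c > 0, ω > 0 and let a: (r̄, ∞) → ℝ be a function such that for all r > r̄ and all r' ∈ [(1.1/.9) r, 10 r], a(r') ≥ a(r) − c r^{−ω} (so that lim_{r→∞} a(r) exists in ℝ ∪ {+∞}). Then lim_{r→∞} a(r) is finite if and only if there exists a sequence r_k → ∞ with r_k > (1.1/.9) r̄ and r_{k+1} > (1.1/.9) r_k for all k, such that lim_{k→∞} sup_{r' > (1.1/.9) r_k} ( a((1.1/.9) r') − a((.9/1.1) r_k) ) = 0. -/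
/-- One-step almost-monotonicity on the windows `[(1.1/.9) r, 10 r]` chains, by doubling the radius,
to almost-monotonicity on the half-lines `[(1.1/.9) r, ∞)`, with the geometric-series constant. -/
lemma sub_mul_rpow_le_of_window {rbar c ω : ℝ} (hrbar : 0 < rbar) (hc : 0 < c) (hω : 0 < ω)
    {a : ℝ → ℝ}
    (ha : ∀ r > rbar, ∀ r' : ℝ, (1.1 / 0.9) * r ≤ r' → r' ≤ 10 * r →
      a r' ≥ a r - c * r ^ (-ω))
    {r s : ℝ} (hr : rbar < r) (hs : (1.1 / 0.9) * r ≤ s) :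
    a r - c / (1 - 2 ^ (-ω)) * r ^ (-ω) ≤ a s := by
  have hlt : (2 : ℝ) ^ (-ω) < 1 := Real.rpow_lt_one_of_one_lt_of_neg one_lt_two (by linarith)
  have hpos : (0 : ℝ) < 2 ^ (-ω) := Real.rpow_pos_of_pos two_pos _
  set C := c / (1 - 2 ^ (-ω)) with hC
  have hCeq : c + C * 2 ^ (-ω) = C := by
    have : (1 : ℝ) - 2 ^ (-ω) ≠ 0 := by linarith
    rw [hC]
    field_simp
    ring
  have hC0 : 0 < C := div_pos hc (by linarith)
  have hcC : c ≤ C := by linarith [mul_pos hC0 hpos]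
  have key : ∀ n : ℕ, ∀ r, rbar < r → (1.1 / 0.9) * r ≤ s → s ≤ 2 ^ n * (10 * r) →
      a r - C * r ^ (-ω) ≤ a s := by
    intro n
    induction n with
    | zero =>
      intro r hr hs hsn
      have h := ha r hr s hs (by simpa using hsn)
      have := mul_le_mul_of_nonneg_right hcC (Real.rpow_nonneg (hrbar.trans hr).le (-ω))
      linarith
    | succ n ih =>
      intro r hr hs hsn
      have hr0 := hrbar.trans hr
      by_cases h10 : s ≤ 10 * r
      · have h := ha r hr s hs h10
        have := mul_le_mul_of_nonneg_right hcC (Real.rpow_nonneg hr0.le (-ω))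
        linarith
      · have h1 := ha r hr (2 * r) (by norm_num; linarith) (by linarith)
        have h2 := ih (2 * r) (by linarith) (by norm_num; linarith)
          (hsn.trans_eq (by ring))
        rw [Real.mul_rpow two_pos.le hr0.le, ← mul_assoc] at h2
        have h3 : c * r ^ (-ω) + C * 2 ^ (-ω) * r ^ (-ω) = C * r ^ (-ω) := by
          rw [← add_mul, hCeq]
        linarith
  have hr0 := hrbar.trans hr
  obtain ⟨n, hn⟩ := pow_unbounded_of_one_lt (s / (10 * r)) one_lt_two
  exact key n r hr hs ((div_lt_iff₀ (by linarith)).1 hn).le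


/-- **Finiteness criterion for the limit at infinity of an almost-monotone
radial function.**
Suppose `a : (r̄,∞) → ℝ` satisfies `a r' ≥ a r - c r^{-ω}` for all `r > r̄` and
all `r' ∈ [(1.1/.9) r, 10 r]` (so that `lim_{r→∞} a r` exists in `ℝ ∪ {+∞}`).
Then the limit is finite iff there is a sequence `r_k → ∞` with
`r_k > (1.1/.9) r̄` and `r_{k+1} > (1.1/.9) r_k`, such that
`sup_{r' > (1.1/.9) r_k} (a((1.1/.9) r') - a((.9/1.1) r_k)) → 0` as `k → ∞`;
the convergence of the suprema to `0` is expressed by the `ε`-characterization: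
for every `ε > 0`, eventually in `k` the quantity
`a((1.1/.9) r') - a((.9/1.1) r_k)` is `≤ ε` for *all* `r' > (1.1/.9) r_k`,
and is `≥ -ε` for *some* `r' > (1.1/.9) r_k`. -/
theorem almost_monotone_radial_limit_finite_iff (rbar c ω : ℝ) (hrbar : 0 < rbar)
    (hc : 0 < c) (hω : 0 < ω) (a : ℝ → ℝ)
    (ha : ∀ r > rbar, ∀ r' : ℝ, (1.1 / 0.9) * r ≤ r' → r' ≤ 10 * r →
      a r' ≥ a r - c * r ^ (-ω)) :
    (∃ L : ℝ, Filter.Tendsto a Filter.atTop (nhds L)) ↔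
      ∃ rk : ℕ → ℝ,
        Filter.Tendsto rk Filter.atTop Filter.atTop ∧
        (∀ k, (1.1 / 0.9) * rbar < rk k) ∧
        (∀ k, (1.1 / 0.9) * rk k < rk (k + 1)) ∧
        (∀ ε > (0 : ℝ), ∃ K : ℕ, ∀ k ≥ K,
          (∀ r' : ℝ, (1.1 / 0.9) * rk k < r' →
            a ((1.1 / 0.9) * r') - a ((0.9 / 1.1) * rk k) ≤ ε) ∧
          (∃ r' : ℝ, (1.1 / 0.9) * rk k < r' ∧
            -ε ≤ a ((1.1 / 0.9) * r') - a ((0.9 / 1.1) * rk k))) := by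
  constructor
  · rintro ⟨L, hL⟩
    have hpow : Filter.Tendsto (fun k : ℕ => 2 * rbar * 2 ^ k) Filter.atTop Filter.atTop :=
      (tendsto_pow_atTop_atTop_of_one_lt one_lt_two).const_mul_atTop (by linarith)
    refine ⟨fun k => 2 * rbar * 2 ^ k, hpow, fun k => ?_, fun k => ?_, fun ε hε => ?_⟩
    · have : (1 : ℝ) ≤ 2 ^ k := one_le_pow₀ one_le_two
      norm_num
      nlinarith
    · have : (0 : ℝ) < 2 * rbar * 2 ^ k := by positivity
      simp only [pow_succ]
      norm_num
      linarith
    · obtain ⟨R, hR⟩ := Metric.tendsto_atTop.1 hL (ε / 2) (by linarith)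
      obtain ⟨K, hK⟩ := Filter.eventually_atTop.1
        (hpow.eventually_ge_atTop ((1.1 / 0.9) * R))
      have close : ∀ k ≥ K, ∀ r' : ℝ, (1.1 / 0.9) * (2 * rbar * 2 ^ k) < r' →
          |a ((1.1 / 0.9) * r') - a ((0.9 / 1.1) * (2 * rbar * 2 ^ k))| ≤ ε := by
        intro k hk r' hr'
        have hRk := hK k hk
        have hk0 : (0 : ℝ) < 2 * rbar * 2 ^ k := by positivity
        generalize 2 * rbar * 2 ^ k = x at *
        norm_num at hr' hRk
        have h1 := hR ((1.1 / 0.9) * r') (by norm_num; linarith)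
        have h2 := hR ((0.9 / 1.1) * x) (by norm_num; linarith)
        rw [Real.dist_eq, abs_lt] at h1 h2
        exact abs_le.2 ⟨by linarith, by linarith⟩
      refine ⟨K, fun k hk => ⟨fun r' hr' => (abs_le.1 (close k hk r' hr')).2, ?_⟩⟩
      obtain ⟨r', hr'⟩ := exists_gt ((1.1 / 0.9) * (2 * rbar * 2 ^ k))
      exact ⟨r', hr', (abs_le.1 (close k hk r' hr')).1⟩
  · rintro ⟨rk, hrk, hrk_gt, -, hsup⟩
    refine cauchy_map_iff_exists_tendsto.1 (Metric.cauchy_iff.2 ⟨inferInstance, fun ε hε => ?_⟩)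
    obtain ⟨K, hK⟩ := hsup (ε / 3) (by linarith)
    have hdecay : Filter.Tendsto
        (fun k => c / (1 - 2 ^ (-ω)) * ((0.9 / 1.1) * rk k) ^ (-ω)) Filter.atTop (nhds 0) := by
      simpa using ((tendsto_rpow_neg_atTop hω).comp
        (hrk.const_mul_atTop (by norm_num : (0 : ℝ) < 0.9 / 1.1))).const_mul (c / (1 - 2 ^ (-ω)))
    obtain ⟨k, hkε, hkK⟩ := ((hdecay.eventually_lt_const (by linarith : (0 : ℝ) < ε / 3)).and
      (Filter.eventually_ge_atTop K)).exists
    have hk := hrk_gt k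
    have close : ∀ s > (1.1 / 0.9) * ((1.1 / 0.9) * rk k),
        |a s - a ((0.9 / 1.1) * rk k)| ≤ ε / 3 := by
      intro s hs
      have upper := (hK k hkK).1 ((0.9 / 1.1) * s) (by norm_num at hs ⊢; linarith)
      rw [show (1.1 / 0.9 : ℝ) * ((0.9 / 1.1) * s) = s by ring] at upper
      have lower := sub_mul_rpow_le_of_window hrbar hc hω ha
        (r := (0.9 / 1.1) * rk k) (s := s) (by norm_num at hk ⊢; linarith)
        (by norm_num at hk hs ⊢; linarith)
      exact abs_le.2 ⟨by linarith, upper⟩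
    refine ⟨a '' Set.Ioi ((1.1 / 0.9) * ((1.1 / 0.9) * rk k)),
      Filter.image_mem_map (Filter.Ioi_mem_atTop _), ?_⟩
    rintro _ ⟨s, hs, rfl⟩ _ ⟨t, ht, rfl⟩
    have h1 := abs_le.1 (close s hs)
    have h2 := abs_le.1 (close t ht)
    rw [Real.dist_eq, abs_lt]
    constructor <;> linarith
end
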